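/- arXiv:1504.03502 — 6 statements merged into one kernel-verified Lean document; each statement's English description precedes it below -/
import Mathlib

section
/- There exist exactly two equivalence classes of binary [16,7] codes satisfying the conditions (C1) and (C2) (with m = 4, n = 16): there are two inequivalent [16,7] codes satisfying the conditions, one of minimum weight 6 and one of minimum weight 4, and every [16,7] code satisfying the conditions is equivalent to one of them. -/
open Finset

/-- The (Hamming) weight of a vector over `ZMod 2`. -/
def wt {ι : Type*} [Fintype ι] (x : ι → ZMod 2) : ℕ :=
  (Finset.univ.filter fun i => x i ≠ 0).card

/-- The first order Reed–Muller code `RM(1,m)`: coordinates are indexed by the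
points of `F_2^m`, and the codewords are the evaluation vectors
`v ↦ a·v + b` for `a ∈ F_2^m`, `b ∈ F_2`. -/
def RM1 (m : ℕ) : Set ((Fin m → ZMod 2) → ZMod 2) :=
  {f | ∃ (a : Fin m → ZMod 2) (b : ZMod 2), f = fun v => (∑ i, a i * v i) + b}

/-- A binary `[2^m, k]` code `C` satisfies conditions (C1) and (C2) with respect to
a positive integer `a` with `0 < a < 2^m/2`:
(C1) the set of weights of codewords of `C` is exactly
`{0, 2^m/2 - a, 2^m/2, 2^m/2 + a, 2^m}`, and
(C2) `C` contains `RM(1,m)` as a subcode. -/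
def SatCond (m k a : ℕ) (C : Submodule (ZMod 2) ((Fin m → ZMod 2) → ZMod 2)) : Prop :=
  Module.finrank (ZMod 2) C = k ∧ 0 < a ∧ a < 2 ^ m / 2 ∧
  {w : ℕ | ∃ x ∈ C, wt x = w} =
    ({0, 2 ^ m / 2 - a, 2 ^ m / 2, 2 ^ m / 2 + a, 2 ^ m} : Set ℕ) ∧
  RM1 m ⊆ (C : Set ((Fin m → ZMod 2) → ZMod 2))

/-- `Ai C i` is the number `A_i(C)` of codewords of weight `i` in `C`. -/
noncomputable def Ai {ι : Type*} [Fintype ι] (C : Set (ι → ZMod 2)) (i : ℕ) : ℕ :=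
  {x ∈ C | wt x = i}.ncard

/-- The minimum (nonzero) weight of a code. -/
noncomputable def dmin {ι : Type*} [Fintype ι] (C : Set (ι → ZMod 2)) : ℕ :=
  sInf {w : ℕ | ∃ x ∈ C, x ≠ 0 ∧ wt x = w}

/-- Two binary codes of the same length are equivalent if one is obtained from
the other by a permutation of the coordinates. -/
def CodeEquiv {ι : Type*} [Fintype ι] (C C' : Set (ι → ZMod 2)) : Prop :=
  ∃ σ : Equiv.Perm ι, C' = (fun x => x ∘ σ) '' C

/-- The dual code of a binary code. -/
def dualCode {ι : Type*} [Fintype ι] (C : Submodule (ZMod 2) (ι → ZMod 2)) :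
    Submodule (ZMod 2) (ι → ZMod 2) where
  carrier := {x | ∀ y ∈ C, ∑ i, x i * y i = 0}
  add_mem' := by
    intro x₁ x₂ h₁ h₂ y hy
    simp only [Set.mem_setOf_eq] at h₁ h₂ ⊢
    simp only [Pi.add_apply, add_mul, Finset.sum_add_distrib, h₁ y hy, h₂ y hy, add_zero]
  zero_mem' := by
    intro y hy
    simp
  smul_mem' := by
    intro c x hx y hy
    simp only [Set.mem_setOf_eq] at hx ⊢
    simp only [Pi.smul_apply, smul_eq_mul, mul_assoc, ← Finset.mul_sum, hx y hy, mul_zero]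

/-- The covering radius `ρ(C) = max_x min_{c ∈ C} wt (x - c)`. -/
noncomputable def covRad {ι : Type*} [Fintype ι] (C : Set (ι → ZMod 2)) : ℕ :=
  sSup {r : ℕ | ∃ x : ι → ZMod 2, r = sInf {w : ℕ | ∃ c ∈ C, w = wt (x - c)}}

/-- A code of length `2^m` satisfying the conditions (C1) and (C2) is maximal if it is
not properly contained in any code of length `2^m` satisfying the conditions. -/
def MaximalSat (m : ℕ) (C : Submodule (ZMod 2) ((Fin m → ZMod 2) → ZMod 2)) : Prop :=
  (∃ k a, SatCond m k a C) ∧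
  ∀ D : Submodule (ZMod 2) ((Fin m → ZMod 2) → ZMod 2),
    (∃ k a, SatCond m k a D) → C ≤ D → D = C

/-- `P` has exactly `N` equivalence classes of codes. -/
def ExactlyNClasses {m : ℕ} (N : ℕ)
    (P : Submodule (ZMod 2) ((Fin m → ZMod 2) → ZMod 2) → Prop) : Prop :=
  ∃ f : Fin N → Submodule (ZMod 2) ((Fin m → ZMod 2) → ZMod 2),
    (∀ i, P (f i)) ∧
    (∀ i j, i ≠ j →
      ¬ CodeEquiv (↑(f i) : Set ((Fin m → ZMod 2) → ZMod 2)) (↑(f j))) ∧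
    ∀ C, P C → ∃ i, CodeEquiv (↑C : Set ((Fin m → ZMod 2) → ZMod 2)) (↑(f i))

/-- A weighing matrix of order `n` and weight `k`. -/
def IsWeighing (n k : ℕ) (W : Matrix (Fin n) (Fin n) ℤ) : Prop :=
  (∀ i j, W i j = 0 ∨ W i j = 1 ∨ W i j = -1) ∧
  W * W.transpose = (k : ℤ) • (1 : Matrix (Fin n) (Fin n) ℤ)

/-- A Hadamard matrix of order `n`. -/
def IsHadamard (n : ℕ) (H : Matrix (Fin n) (Fin n) ℤ) : Prop :=
  (∀ i j, H i j = 1 ∨ H i j = -1) ∧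
  H * H.transpose = (n : ℤ) • (1 : Matrix (Fin n) (Fin n) ℤ)

/-- Coefficients of a quadratic form `∑_{i<j} p_ij x_i x_j`, in the order
01, 02, 03, 12, 13, 23. -/
abbrev B6 := Bool × Bool × Bool × Bool × Bool × Bool

/-- `Bool` as an element of `ZMod 2`. -/
def zb (b : Bool) : ZMod 2 := cond b 1 0

/-- Element of `ZMod 2` as a `Bool`. -/
def bz (x : ZMod 2) : Bool := decide (x ≠ 0)

lemma bz_add (x y : ZMod 2) : bz (x + y) = xor (bz x) (bz y) := by
  revert x y; decide

lemma zb_bz (x : ZMod 2) : zb (bz x) = x := by revert x; decide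

lemma bz_zb (x : Bool) : bz (zb x) = x := by revert x; decide

/-- The quadratic form evaluated on scalars. -/
def Qs (p : B6) (x y z w : ZMod 2) : ZMod 2 :=
  zb p.1 * (x * y) + zb p.2.1 * (x * z) + zb p.2.2.1 * (x * w) + zb p.2.2.2.1 * (y * z)
    + zb p.2.2.2.2.1 * (y * w) + zb p.2.2.2.2.2 * (z * w)

/-- The quadratic form as a function. -/
def Qf (p : B6) (v : Fin 4 → ZMod 2) : ZMod 2 := Qs p (v 0) (v 1) (v 2) (v 3)

/-- Componentwise addition. -/
def addB (p q : B6) : B6 :=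
  (xor p.1 q.1, xor p.2.1 q.2.1, xor p.2.2.1 q.2.2.1, xor p.2.2.2.1 q.2.2.2.1,
    xor p.2.2.2.2.1 q.2.2.2.2.1, xor p.2.2.2.2.2 q.2.2.2.2.2)

/-- Pfaffian. -/
def pfB (p : B6) : Bool :=
  xor (p.1 && p.2.2.2.2.2) (xor (p.2.1 && p.2.2.2.2.1) (p.2.2.1 && p.2.2.2.1))

lemma zb_xor (x y : Bool) : zb (xor x y) = zb x + zb y := by revert x y; decide

lemma Qf_add (p q : B6) : Qf (addB p q) = Qf p + Qf q := by
  funext v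
  simp only [Qf, Qs, addB, zb_xor, Pi.add_apply]
  ring

/-- Parametrization of the code generated by `RM(1,4)` and two quadratic forms. -/
def gen (p q : B6) : ((Fin 4 → ZMod 2) × ZMod 2 × ZMod 2 × ZMod 2) →ₗ[ZMod 2]
    ((Fin 4 → ZMod 2) → ZMod 2) where
  toFun c := fun v => (∑ i, c.1 i * v i) + c.2.1 + c.2.2.1 * Qf p v + c.2.2.2 * Qf q v
  map_add' x y := by
    funext v
    simp only [Fin.sum_univ_four, Prod.fst_add, Prod.snd_add, Pi.add_apply]
    ring
  map_smul' r x := by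
    funext v
    simp only [Fin.sum_univ_four, Prod.smul_fst, Prod.smul_snd, Pi.smul_apply, smul_eq_mul,
      RingHom.id_apply]
    ring

/-- The code generated by `RM(1,4)` and two quadratic forms. -/
def Code (p q : B6) : Submodule (ZMod 2) ((Fin 4 → ZMod 2) → ZMod 2) := LinearMap.range (gen p q)

lemma RM1_sub (p q : B6) : RM1 4 ⊆ (Code p q : Set ((Fin 4 → ZMod 2) → ZMod 2)) := by
  rintro f ⟨a, b, rfl⟩
  refine ⟨(a, b, 0, 0), ?_⟩
  funext v
  simp [gen]

lemma Qf_mem_left (p q : B6) : Qf p ∈ Code p q :=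
  ⟨(0, 0, 1, 0), by funext v; simp [gen]⟩

lemma Qf_mem_right (p q : B6) : Qf q ∈ Code p q :=
  ⟨(0, 0, 0, 1), by funext v; simp [gen]⟩

lemma Code_le (p q : B6) (C : Submodule (ZMod 2) ((Fin 4 → ZMod 2) → ZMod 2))
    (h : RM1 4 ⊆ (C : Set ((Fin 4 → ZMod 2) → ZMod 2))) (hp : Qf p ∈ C) (hq : Qf q ∈ C) :
    Code p q ≤ C := by
  rintro f ⟨⟨a, b, s, t⟩, rfl⟩
  have h1 : (fun v : Fin 4 → ZMod 2 => (∑ i, a i * v i) + b) ∈ C := h ⟨a, b, rfl⟩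
  have := C.add_mem (C.add_mem h1 (C.smul_mem s hp)) (C.smul_mem t hq)
  exact this

lemma gen_inj (p q : B6) (hp : p ≠ (false, false, false, false, false, false))
    (hq : q ≠ (false, false, false, false, false, false)) (hpq : p ≠ q) :
    Function.Injective (gen p q) := by
  rw [injective_iff_map_eq_zero]
  rintro ⟨a, b, s, t⟩ h
  have hv : ∀ v, (∑ i, a i * v i) + b + s * Qf p v + t * Qf q v = 0 := fun v => congrFun h v
  have h0 := hv ![0, 0, 0, 0]
  have h1 := hv ![1, 0, 0, 0]
  have h2 := hv ![0, 1, 0, 0]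
  have h3 := hv ![0, 0, 1, 0]
  have h4 := hv ![0, 0, 0, 1]
  have h12 := hv ![1, 1, 0, 0]
  have h13 := hv ![1, 0, 1, 0]
  have h14 := hv ![1, 0, 0, 1]
  have h23 := hv ![0, 1, 1, 0]
  have h24 := hv ![0, 1, 0, 1]
  have h34 := hv ![0, 0, 1, 1]
  simp [Qf, Qs, Fin.sum_univ_four] at h0
  subst h0
  simp [Qf, Qs, Fin.sum_univ_four] at h1 h2 h3 h4
  simp [Qf, Qs, Fin.sum_univ_four, h1, h2, h3, h4] at h12 h13 h14 h23 h24 h34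
  have ha : a = 0 := by funext i; fin_cases i <;> simp [h1, h2, h3, h4]
  have key : ∀ s t x y : ZMod 2, s * x + t * y = 0 →
      (s = 1 → t = 0 → x = 0) ∧ (s = 0 → t = 1 → y = 0) ∧ (s = 1 → t = 1 → x = y) := by decide
  have zinj : ∀ x y, zb x = zb y → x = y := by decide
  have zz : ∀ x, zb x = 0 → x = false := by decide
  have k1 := key _ _ _ _ h12
  have k2 := key _ _ _ _ h13
  have k3 := key _ _ _ _ h14
  have k4 := key _ _ _ _ h23
  have k5 := key _ _ _ _ h24
  have k6 := key _ _ _ _ h34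
  have hst : (s = 0 ∧ t = 0) ∨ (s = 1 ∧ t = 0) ∨ (s = 0 ∧ t = 1) ∨ (s = 1 ∧ t = 1) := by
    have : ∀ s t : ZMod 2,
      (s = 0 ∧ t = 0) ∨ (s = 1 ∧ t = 0) ∨ (s = 0 ∧ t = 1) ∨ (s = 1 ∧ t = 1) := by decide
    exact this s t
  rcases hst with ⟨hs, ht⟩ | ⟨hs, ht⟩ | ⟨hs, ht⟩ | ⟨hs, ht⟩
  · subst hs ht ha; rfl
  · exfalso; apply hp
    obtain ⟨p1, p2, p3, p4, p5, p6⟩ := p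
    simp only [Prod.mk.injEq]
    exact ⟨zz _ (k1.1 hs ht), zz _ (k2.1 hs ht), zz _ (k3.1 hs ht), zz _ (k4.1 hs ht),
      zz _ (k5.1 hs ht), zz _ (k6.1 hs ht)⟩
  · exfalso; apply hq
    obtain ⟨p1, p2, p3, p4, p5, p6⟩ := q
    simp only [Prod.mk.injEq]
    exact ⟨zz _ (k1.2.1 hs ht), zz _ (k2.2.1 hs ht), zz _ (k3.2.1 hs ht), zz _ (k4.2.1 hs ht),
      zz _ (k5.2.1 hs ht), zz _ (k6.2.1 hs ht)⟩
  · exfalso; apply hpq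
    obtain ⟨p1, p2, p3, p4, p5, p6⟩ := p
    obtain ⟨q1, q2, q3, q4, q5, q6⟩ := q
    simp only [Prod.mk.injEq]
    exact ⟨zinj _ _ (k1.2.2 hs ht), zinj _ _ (k2.2.2 hs ht), zinj _ _ (k3.2.2 hs ht),
      zinj _ _ (k4.2.2 hs ht), zinj _ _ (k5.2.2 hs ht), zinj _ _ (k6.2.2 hs ht)⟩

lemma finrank_Code (p q : B6) (hp : p ≠ (false, false, false, false, false, false))
    (hq : q ≠ (false, false, false, false, false, false)) (hpq : p ≠ q) :
    Module.finrank (ZMod 2) (Code p q) = 7 := by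
  rw [Code, LinearMap.finrank_range_of_inj (gen_inj p q hp hq hpq)]
  simp

/-! ### Weights -/

lemma wt_eq (f : (Fin 4 → ZMod 2) → ZMod 2) : wt f =
    (bz (f ![0,0,0,0])).toNat + (bz (f ![1,0,0,0])).toNat + (bz (f ![0,1,0,0])).toNat
    + (bz (f ![1,1,0,0])).toNat + (bz (f ![0,0,1,0])).toNat + (bz (f ![1,0,1,0])).toNat
    + (bz (f ![0,1,1,0])).toNat + (bz (f ![1,1,1,0])).toNat + (bz (f ![0,0,0,1])).toNat
    + (bz (f ![1,0,0,1])).toNat + (bz (f ![0,1,0,1])).toNat + (bz (f ![1,1,0,1])).toNat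
    + (bz (f ![0,0,1,1])).toNat + (bz (f ![1,0,1,1])).toNat + (bz (f ![0,1,1,1])).toNat
    + (bz (f ![1,1,1,1])).toNat := by
  have hl : (Finset.univ : Finset (Fin 4 → ZMod 2)) =
    (⟨([![0,0,0,0], ![1,0,0,0], ![0,1,0,0], ![1,1,0,0], ![0,0,1,0], ![1,0,1,0], ![0,1,1,0],
      ![1,1,1,0], ![0,0,0,1], ![1,0,0,1], ![0,1,0,1], ![1,1,0,1], ![0,0,1,1], ![1,0,1,1],
      ![0,1,1,1], ![1,1,1,1]] : List (Fin 4 → ZMod 2)), by decide +kernel⟩ : Finset _) := by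
    decide +kernel
  have h1 : wt f = ∑ v, (bz (f v)).toNat := by
    rw [wt, Finset.card_filter]
    refine Finset.sum_congr rfl fun v _ => ?_
    unfold bz
    by_cases h : f v = 0 <;> simp [h]
  rw [h1, hl]
  simp only [Finset.sum, Multiset.map_coe, Multiset.sum_coe, List.map_cons, List.map_nil,
    List.sum_cons, List.sum_nil]
  ring

/-- Weight of a normalized function plus a linear function. -/
def wB (p : B6) (t0 t1 t2 t3 u : Bool) (a b c d : Bool) : ℕ :=
  a.toNat + b.toNat + (xor p.1 (xor a b)).toNat + c.toNat
    + (xor p.2.1 (xor a c)).toNat + (xor p.2.2.2.1 (xor b c)).toNat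
    + (xor t3 (xor a (xor b c))).toNat + d.toNat
    + (xor p.2.2.1 (xor a d)).toNat + (xor p.2.2.2.2.1 (xor b d)).toNat
    + (xor t2 (xor a (xor b d))).toNat + (xor p.2.2.2.2.2 (xor c d)).toNat
    + (xor t1 (xor a (xor c d))).toNat + (xor t0 (xor b (xor c d))).toNat
    + (xor u (xor a (xor b (xor c d)))).toNat

/-- Allowed weights. -/
def okw (k w : ℕ) : Bool :=
  Nat.beq w 8 || Nat.beq w (8 - k) || Nat.beq w (8 + k) || Nat.beq w 0 || Nat.beq w 16

/-- Conjunction over both booleans. -/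
def allB (f : Bool → Bool) : Bool := f false && f true

lemma allB_iff (f : Bool → Bool) : allB f = true ↔ ∀ b, f b = true := by
  simp [allB]

/-- Conclusion for a normalized function. -/
def concl (k : ℕ) (p : B6) (t0 t1 t2 t3 u : Bool) : Bool :=
  (Nat.beq k 2 && pfB p || Nat.beq k 4 && !pfB p) &&
  (t3 == xor p.1 (xor p.2.1 p.2.2.2.1)) && (t2 == xor p.1 (xor p.2.2.1 p.2.2.2.2.1)) &&
  (t1 == xor p.2.1 (xor p.2.2.1 p.2.2.2.2.2)) &&
  (t0 == xor p.2.2.2.1 (xor p.2.2.2.2.1 p.2.2.2.2.2)) &&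
  (u == xor p.1 (xor p.2.1 (xor p.2.2.1 (xor p.2.2.2.1 (xor p.2.2.2.2.1 p.2.2.2.2.2)))))

/-- All the functions in the coset have allowed weights. -/
def hypB (k : ℕ) (p : B6) (t0 t1 t2 t3 u : Bool) : Bool :=
  allB fun a => allB fun b => allB fun c => allB fun d => okw k (wB p t0 t1 t2 t3 u a b c d)

/-- Function vanishes. -/
def isz (p : B6) (t0 t1 t2 t3 u : Bool) : Bool :=
  !(p.1 || p.2.1 || p.2.2.1 || p.2.2.2.1 || p.2.2.2.2.1 || p.2.2.2.2.2
    || t0 || t1 || t2 || t3 || u)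

/-- The full test. -/
def testB (k : ℕ) : Bool :=
  allB fun p1 => allB fun p2 => allB fun p3 => allB fun p4 => allB fun p5 => allB fun p6 =>
  allB fun t0 => allB fun t1 => allB fun t2 => allB fun t3 => allB fun u =>
    concl k (p1, p2, p3, p4, p5, p6) t0 t1 t2 t3 u || isz (p1, p2, p3, p4, p5, p6) t0 t1 t2 t3 u
      || !hypB k (p1, p2, p3, p4, p5, p6) t0 t1 t2 t3 u

lemma test1 : testB 1 = true := by decide +kernel
lemma test2 : testB 2 = true := by decide +kernel
lemma test3 : testB 3 = true := by decide +kernel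
lemma test4 : testB 4 = true := by decide +kernel
lemma test5 : testB 5 = true := by decide +kernel
lemma test6 : testB 6 = true := by decide +kernel
lemma test7 : testB 7 = true := by decide +kernel

lemma test_all (k : ℕ) (h0 : 0 < k) (h8 : k < 8) (p : B6) (t0 t1 t2 t3 u : Bool)
    (hz : isz p t0 t1 t2 t3 u = false) (hh : hypB k p t0 t1 t2 t3 u = true) :
    concl k p t0 t1 t2 t3 u = true := by
  have ht : testB k = true := by
    interval_cases k
    exacts [test1, test2, test3, test4, test5, test6, test7]
  obtain ⟨p1, p2, p3, p4, p5, p6⟩ := p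
  simp only [testB, allB_iff] at ht
  have := ht p1 p2 p3 p4 p5 p6 t0 t1 t2 t3 u
  simpa [hz, hh] using this

lemma vec_cases (v : Fin 4 → ZMod 2) :
    v = ![0,0,0,0] ∨ v = ![1,0,0,0] ∨ v = ![0,1,0,0] ∨ v = ![1,1,0,0] ∨
    v = ![0,0,1,0] ∨ v = ![1,0,1,0] ∨ v = ![0,1,1,0] ∨ v = ![1,1,1,0] ∨
    v = ![0,0,0,1] ∨ v = ![1,0,0,1] ∨ v = ![0,1,0,1] ∨ v = ![1,1,0,1] ∨
    v = ![0,0,1,1] ∨ v = ![1,0,1,1] ∨ v = ![0,1,1,1] ∨ v = ![1,1,1,1] := by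
  revert v; decide +kernel

lemma normal_form (k : ℕ) (C : Submodule (ZMod 2) ((Fin 4 → ZMod 2) → ZMod 2))
    (h : SatCond 4 7 k C) (f : (Fin 4 → ZMod 2) → ZMod 2) (hf : f ∈ C) (hne : f ≠ 0)
    (h0 : f ![0,0,0,0] = 0) (h1 : f ![1,0,0,0] = 0) (h2 : f ![0,1,0,0] = 0)
    (h3 : f ![0,0,1,0] = 0) (h4 : f ![0,0,0,1] = 0) :
    ∃ p : B6, f = Qf p ∧ (k = 2 ∧ pfB p = true ∨ k = 4 ∧ pfB p = false) := by
  obtain ⟨-, hk0, hk8, hw, hR⟩ := h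
  set p : B6 := (bz (f ![1,1,0,0]), bz (f ![1,0,1,0]), bz (f ![1,0,0,1]), bz (f ![0,1,1,0]),
    bz (f ![0,1,0,1]), bz (f ![0,0,1,1])) with hp
  have hz0 : bz 0 = false := by decide
  have hb0 : ∀ x, bz x = false → x = 0 := by decide
  have hyp : hypB k p (bz (f ![0,1,1,1])) (bz (f ![1,0,1,1])) (bz (f ![1,1,0,1]))
      (bz (f ![1,1,1,0])) (bz (f ![1,1,1,1])) = true := by
    simp only [hypB, allB_iff]
    intro a b c d
    set l : (Fin 4 → ZMod 2) → ZMod 2 :=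
      fun v => (∑ i, (![zb a, zb b, zb c, zb d] : Fin 4 → ZMod 2) i * v i) + 0 with hl
    have hlC : l ∈ C := hR ⟨_, _, rfl⟩
    have hmem : wt (f + l) ∈ {w : ℕ | ∃ x ∈ C, wt x = w} := ⟨_, C.add_mem hf hlC, rfl⟩
    rw [hw] at hmem
    have hwt : wt (f + l) = wB p (bz (f ![0,1,1,1])) (bz (f ![1,0,1,1])) (bz (f ![1,1,0,1]))
      (bz (f ![1,1,1,0])) (bz (f ![1,1,1,1])) a b c d := by
      rw [wt_eq]
      simp [hl, wB, Fin.sum_univ_four, bz_add, bz_zb, h0, h1, h2, h3, h4, hz0, hp]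
    rw [hwt] at hmem
    simp only [okw, Nat.beq_eq, Bool.or_eq_true]
    simp only [Set.mem_insert_iff, Set.mem_singleton_iff] at hmem
    norm_num at hmem
    omega
  have hz : isz p (bz (f ![0,1,1,1])) (bz (f ![1,0,1,1])) (bz (f ![1,1,0,1]))
      (bz (f ![1,1,1,0])) (bz (f ![1,1,1,1])) = false := by
    rw [Bool.eq_false_iff]
    intro hzz
    apply hne
    simp only [isz, hp, Bool.not_eq_true', Bool.or_eq_false_iff] at hzz
    obtain ⟨⟨⟨⟨⟨⟨⟨⟨⟨⟨z1, z2⟩, z3⟩, z4⟩, z5⟩, z6⟩, z7⟩, z8⟩, z9⟩, z10⟩, z11⟩ := hzz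
    funext v
    rcases vec_cases v with h | h | h | h | h | h | h | h | h | h | h | h | h | h | h | h <;>
      subst h <;> simp only [Pi.zero_apply] <;> first | assumption | (apply hb0; assumption)
  have hc := test_all k hk0 (by simpa using hk8) p _ _ _ _ _ hz hyp
  simp only [concl, Bool.and_eq_true, beq_iff_eq, Bool.or_eq_true, Nat.beq_eq,
    Bool.not_eq_true'] at hc
  obtain ⟨⟨⟨⟨⟨c0, c3⟩, c2⟩, c1⟩, c4⟩, c5⟩ := hc
  refine ⟨p, ?_, c0⟩
  have hb : ∀ x y, bz x = y → x = zb y := by decide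
  replace c1 := hb _ _ c1
  replace c2 := hb _ _ c2
  replace c3 := hb _ _ c3
  replace c4 := hb _ _ c4
  replace c5 := hb _ _ c5
  simp only [zb_xor, hp, zb_bz] at c1 c2 c3 c4 c5
  funext v
  rcases vec_cases v with h | h | h | h | h | h | h | h | h | h | h | h | h | h | h | h <;>
    subst h <;> simp [Qf, Qs, hp, zb_bz, h0, h1, h2, h3, h4, c1, c2, c3, c4, c5] <;> ring

/-! ### Moves -/

/-- Entry of the alternating matrix. -/
def ent (p : B6) (i j : Fin 4) : Bool :=
  match i, j with
  | 0, 1 => p.1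
  | 1, 0 => p.1
  | 0, 2 => p.2.1
  | 2, 0 => p.2.1
  | 0, 3 => p.2.2.1
  | 3, 0 => p.2.2.1
  | 1, 2 => p.2.2.2.1
  | 2, 1 => p.2.2.2.1
  | 1, 3 => p.2.2.2.2.1
  | 3, 1 => p.2.2.2.2.1
  | 2, 3 => p.2.2.2.2.2
  | 3, 2 => p.2.2.2.2.2
  | _, _ => false

/-- Entry after the transvection `e_a ↦ e_a + e_b`. -/
def tent (a b : Fin 4) (p : B6) (i j : Fin 4) : Bool :=
  xor (ent p i j) (xor (cond (i == a) (ent p b j) false) (cond (j == a) (ent p i b) false))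

/-- Transvection acting on forms. -/
def tv (a b : Fin 4) (p : B6) : B6 :=
  (tent a b p 0 1, tent a b p 0 2, tent a b p 0 3, tent a b p 1 2, tent a b p 1 3, tent a b p 2 3)

/-- Transvection acting on points. -/
def tp (a b : Fin 4) (v : Fin 4 → ZMod 2) : Fin 4 → ZMod 2 :=
  fun i => if i = b then v i + v a else v i

lemma tp_tp (a b : Fin 4) (h : a ≠ b) (v : Fin 4 → ZMod 2) : tp a b (tp a b v) = v := by
  funext i
  have h2 : ∀ x y : ZMod 2, x + y + y = x := by decide
  by_cases hi : i = b
  · subst hi; simp [tp, h, h2]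
  · simp [tp, hi]

/-- Transvection as a permutation. -/
def tperm (a b : Fin 4) (h : a ≠ b) : Equiv.Perm (Fin 4 → ZMod 2) :=
  ⟨tp a b, tp a b, tp_tp a b h, tp_tp a b h⟩

lemma tv_tv : ∀ (a b : Fin 4) (_ : a ≠ b) (p : B6), tv a b (tv a b p) = p := by decide +kernel

lemma Qf_tp (a b : Fin 4) (h : a ≠ b) (p : B6) (v : Fin 4 → ZMod 2) :
    Qf p (tp a b v) = Qf (tv a b p) v + zb (ent p a b) * v a := by
  have hsq : ∀ x : ZMod 2, x * x = x := by decide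
  have hzf : zb false = 0 := rfl
  fin_cases a <;> fin_cases b <;> first
    | exact absurd rfl h
    | (simp [Qf, Qs, tp, tv, tent, ent, zb_xor]
       first
         | linear_combination zb p.1 * hsq (v 0)
         | linear_combination zb p.1 * hsq (v 1)
         | linear_combination zb p.2.1 * hsq (v 0)
         | linear_combination zb p.2.1 * hsq (v 2)
         | linear_combination zb p.2.2.1 * hsq (v 0)
         | linear_combination zb p.2.2.1 * hsq (v 3)
         | linear_combination zb p.2.2.2.1 * hsq (v 1)
         | linear_combination zb p.2.2.2.1 * hsq (v 2)
         | linear_combination zb p.2.2.2.2.1 * hsq (v 1)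
         | linear_combination zb p.2.2.2.2.1 * hsq (v 3)
         | linear_combination zb p.2.2.2.2.2 * hsq (v 2)
         | linear_combination zb p.2.2.2.2.2 * hsq (v 3))

lemma coord_mem (p q : B6) (a : Fin 4) : (fun v : Fin 4 → ZMod 2 => v a) ∈ Code p q := by
  apply RM1_sub
  exact ⟨Pi.single a 1, 0, by funext v; simp [Pi.single_apply]⟩

lemma comp_mem (a b : Fin 4) (h : a ≠ b) (p q : B6) (x : (Fin 4 → ZMod 2) → ZMod 2)
    (hx : x ∈ Code p q) : x ∘ tp a b ∈ Code (tv a b p) (tv a b q) := by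
  set D := Code (tv a b p) (tv a b q) with hD
  have hle : Code p q ≤ D.comap (LinearMap.funLeft (ZMod 2) (ZMod 2) (tp a b)) := by
    apply Code_le
    · rintro f ⟨c, d, rfl⟩
      change (fun v : Fin 4 → ZMod 2 => (∑ i, c i * tp a b v i) + d) ∈ D
      have h1 : (fun v : Fin 4 → ZMod 2 => (∑ i, c i * v i) + d) ∈ D :=
        RM1_sub _ _ ⟨c, d, rfl⟩
      have h2 := D.add_mem h1 (D.smul_mem (c b) (coord_mem (tv a b p) (tv a b q) a))
      convert h2 using 1
      funext v
      have : ∀ i, c i * tp a b v i = c i * v i + if i = b then c i * v a else 0 := by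
        intro i
        by_cases hi : i = b <;> simp [tp, hi, mul_add]
      simp only [this, Finset.sum_add_distrib, Finset.sum_ite_eq', Finset.mem_univ, if_true,
        Pi.add_apply, Pi.smul_apply, smul_eq_mul]
      ring
    · change (fun v => Qf p (tp a b v)) ∈ D
      simp only [Qf_tp a b h]
      exact D.add_mem (Qf_mem_left _ _) (D.smul_mem (zb (ent p a b)) (coord_mem _ _ a))
    · change (fun v => Qf q (tp a b v)) ∈ D
      simp only [Qf_tp a b h]
      exact D.add_mem (Qf_mem_right _ _) (D.smul_mem (zb (ent q a b)) (coord_mem _ _ a))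
  exact hle hx

/-- Equivalence of the associated codes. -/
def EQ (x y : B6 × B6) : Prop :=
  CodeEquiv (Code x.1 x.2 : Set ((Fin 4 → ZMod 2) → ZMod 2)) (Code y.1 y.2)

lemma EQ_refl (x : B6 × B6) : EQ x x := ⟨1, by simp⟩

lemma EQ_trans {x y z : B6 × B6} (h1 : EQ x y) (h2 : EQ y z) : EQ x z := by
  obtain ⟨s, hs⟩ := h1
  obtain ⟨t, ht⟩ := h2
  refine ⟨t.trans s, ?_⟩
  rw [ht, hs, Set.image_image]
  rfl

lemma EQ_tv (a b : Fin 4) (h : a ≠ b) (x : B6 × B6) : EQ x (tv a b x.1, tv a b x.2) := by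
  refine ⟨tperm a b h, ?_⟩
  ext f
  constructor
  · intro hf
    refine ⟨f ∘ tp a b, ?_, ?_⟩
    · have := comp_mem a b h _ _ f hf
      simp only [tv_tv a b h] at this
      exact this
    · funext v
      exact congrArg f (tp_tp a b h v)
  · rintro ⟨g, hg, rfl⟩
    exact comp_mem a b h _ _ g hg

lemma EQ_add (x : B6 × B6) : EQ x (addB x.1 x.2, x.2) := by
  refine ⟨1, ?_⟩
  have : Code (addB x.1 x.2) x.2 = Code x.1 x.2 := by
    apply le_antisymm
    · apply Code_le _ _ _ (RM1_sub _ _) _ (Qf_mem_right _ _)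
      rw [Qf_add]
      exact Submodule.add_mem _ (Qf_mem_left _ _) (Qf_mem_right _ _)
    · apply Code_le _ _ _ (RM1_sub _ _) _ (Qf_mem_right _ _)
      have h : Qf x.1 = Qf (addB x.1 x.2) - Qf x.2 := by rw [Qf_add]; simp
      rw [h]
      exact Submodule.sub_mem _ (Qf_mem_left _ _) (Qf_mem_right _ _)
  simp [this]

/-- Numerical key of a form. -/
def key6 (p : B6) : ℕ :=
  p.1.toNat + 2 * p.2.1.toNat + 4 * p.2.2.1.toNat + 8 * p.2.2.2.1.toNat
    + 16 * p.2.2.2.2.1.toNat + 32 * p.2.2.2.2.2.toNat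

/-- Numerical key of a pair. -/
def key12 (x : B6 × B6) : ℕ := key6 x.1 + 64 * key6 x.2

/-- Apply a word of transvections, or basis change for the empty word. -/
def mv (w : List (Fin 4 × Fin 4)) (x : B6 × B6) : B6 × B6 :=
  match w with
  | [] => x
  | ab :: w => mv w (tv ab.1 ab.2 x.1, tv ab.1 ab.2 x.2)

/-- Keep the smaller one. -/
def better (x y : B6 × B6) : B6 × B6 := cond (Nat.ble (key12 x) (key12 y)) x y

/-- Force evaluation of a boolean. -/
def fb {α : Type} (b : Bool) (k : Bool → α) : α := cond b (k true) (k false)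

lemma fb_eq {α : Type} (b : Bool) (k : Bool → α) : fb b k = k b := by cases b <;> rfl

/-- Force evaluation of a form. -/
def fq {α : Type} (p : B6) (k : B6 → α) : α :=
  fb p.1 fun a => fb p.2.1 fun b => fb p.2.2.1 fun c => fb p.2.2.2.1 fun d =>
  fb p.2.2.2.2.1 fun e => fb p.2.2.2.2.2 fun f => k (a, b, c, d, e, f)

lemma fq_eq {α : Type} (p : B6) (k : B6 → α) : fq p k = k p := by simp only [fq, fb_eq]

/-- Force evaluation of a pair. -/
def fpair {α : Type} (x : B6 × B6) (k : B6 × B6 → α) : α :=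
  fq x.1 fun a => fq x.2 fun b => k (a, b)

lemma fpair_eq {α : Type} (x : B6 × B6) (k : B6 × B6 → α) : fpair x k = k x := by
  simp only [fpair, fq_eq]

/-- Change of basis. -/
def chg (x : B6 × B6) : B6 × B6 := (addB x.1 x.2, x.2)

/-- One pass, in continuation style. -/
def onePass (x : B6 × B6) (k : B6 × B6 → Bool) : Bool :=
  fpair (better x (chg x)) fun x =>
  fpair (better x (mv [(1, 2)] x)) fun x =>
  fpair (better x (mv [(1, 3)] x)) fun x =>
  fpair (better x (mv [(0, 1), (1, 0)] x)) fun x =>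
  fpair (better x (mv [(1, 2), (2, 1)] x)) fun x =>
  fpair (better x (mv [(2, 3), (3, 2)] x)) k

lemma EQ_mv (w : List (Fin 4 × Fin 4)) (hw : ∀ ab ∈ w, ab.1 ≠ ab.2) (x : B6 × B6) :
    EQ x (mv w x) := by
  induction w generalizing x with
  | nil => exact EQ_refl x
  | cons ab w ih =>
    exact EQ_trans (EQ_tv ab.1 ab.2 (hw ab (by simp)) x)
      (ih (fun c hc => hw c (by simp [hc])) _)

lemma EQ_better {x y z : B6 × B6} (h : EQ x y) (h' : EQ y z) : EQ x (better y z) := by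
  unfold better
  cases Nat.ble (key12 y) (key12 z)
  · exact EQ_trans h h'
  · exact h

lemma EQ_pass {x y : B6 × B6} (h : EQ x y) (k : B6 × B6 → Bool) (hk : onePass y k = true) :
    ∃ z, EQ x z ∧ k z = true := by
  simp only [onePass, fpair_eq] at hk
  refine ⟨_, ?_, hk⟩
  refine EQ_better ?_ (EQ_mv _ (by decide) _)
  refine EQ_better ?_ (EQ_mv _ (by decide) _)
  refine EQ_better ?_ (EQ_mv _ (by decide) _)
  refine EQ_better ?_ (EQ_mv _ (by decide) _)
  refine EQ_better ?_ (EQ_mv _ (by decide) _)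
  exact EQ_better h (EQ_add _)

/-- First form of the code of minimum weight 6. -/
def pA : B6 := (false, true, true, false, true, false)
/-- Second form of the code of minimum weight 6. -/
def qA : B6 := (false, false, true, true, false, false)
/-- First form of the code of minimum weight 4. -/
def pB : B6 := (false, true, false, false, false, false)
/-- Second form of the code of minimum weight 4. -/
def qB : B6 := (true, false, false, false, false, false)

/-- Zero test. -/
def nz (p : B6) : Bool := p.1 || p.2.1 || p.2.2.1 || p.2.2.2.1 || p.2.2.2.2.1 || p.2.2.2.2.2

/-- Reduction test for one pair. -/
def redB (x : B6 × B6) : Bool :=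
  !(nz x.1) || !(nz x.2) || !(nz (addB x.1 x.2)) || (xor (pfB x.1) (pfB x.2)) ||
    (xor (pfB x.1) (pfB (addB x.1 x.2))) ||
    onePass x fun x => onePass x fun x => onePass x fun x => onePass x fun x => onePass x fun x =>
      (Nat.beq (key12 x) 66 || Nat.beq (key12 x) 790)

/-- Reduction test. -/
def redAll : Bool :=
  allB fun p1 => allB fun p2 => allB fun p3 => allB fun p4 => allB fun p5 => allB fun p6 =>
  allB fun q1 => allB fun q2 => allB fun q3 => allB fun q4 => allB fun q5 => allB fun q6 =>
    redB ((p1, p2, p3, p4, p5, p6), (q1, q2, q3, q4, q5, q6))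

lemma redAll_true : redAll = true := by decide +kernel

lemma key6_inj (p : B6) : (key6 p = 2 → p = pB) ∧ (key6 p = 1 → p = qB) ∧
    (key6 p = 22 → p = pA) ∧ (key6 p = 12 → p = qA) ∧ key6 p < 64 := by
  obtain ⟨p1, p2, p3, p4, p5, p6⟩ := p
  cases p1 <;> cases p2 <;> cases p3 <;> cases p4 <;> cases p5 <;> cases p6 <;>
    simp [key6, pA, qA, pB, qB]

lemma classify (p q : B6) (hp : nz p = true) (hq : nz q = true) (hpq : nz (addB p q) = true)
    (h1 : pfB p = pfB q) (h2 : pfB p = pfB (addB p q)) :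
    EQ (p, q) (pA, qA) ∨ EQ (p, q) (pB, qB) := by
  have ht := redAll_true
  obtain ⟨p1, p2, p3, p4, p5, p6⟩ := p
  obtain ⟨q1, q2, q3, q4, q5, q6⟩ := q
  simp only [redAll, allB_iff] at ht
  replace ht := ht p1 p2 p3 p4 p5 p6 q1 q2 q3 q4 q5 q6
  simp only [redB, hp, hq, hpq, ← h1, ← h2, Bool.not_true, Bool.xor_self, Bool.false_or] at ht
  have hE := EQ_refl ((p1, p2, p3, p4, p5, p6), (q1, q2, q3, q4, q5, q6))
  obtain ⟨z1, hE, ht⟩ := EQ_pass hE _ ht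
  obtain ⟨z2, hE, ht⟩ := EQ_pass hE _ ht
  obtain ⟨z3, hE, ht⟩ := EQ_pass hE _ ht
  obtain ⟨z4, hE, ht⟩ := EQ_pass hE _ ht
  obtain ⟨⟨y1, y2⟩, hE, ht⟩ := EQ_pass hE _ ht
  simp only [Bool.or_eq_true, Nat.beq_eq] at ht
  simp only [key12] at ht
  have k1 := key6_inj y1
  have k2 := key6_inj y2
  rcases ht with ht | ht
  · right
    have e1 := k1.1 (by omega)
    have e2 := k2.2.1 (by omega)
    rwa [e1, e2] at hE
  · left
    have e1 := k1.2.2.1 (by omega)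
    have e2 := k2.2.2.2.1 (by omega)
    rwa [e1, e2] at hE

/-! ### The two codes -/

lemma wtA : ∀ (x y z w b s t : ZMod 2), wt (gen pA qA (![x, y, z, w], b, s, t)) ∈
    ({0, 6, 8, 10, 16} : Finset ℕ) := by decide +kernel

lemma wtB : ∀ (x y z w b s t : ZMod 2), wt (gen pB qB (![x, y, z, w], b, s, t)) ∈
    ({0, 4, 8, 12, 16} : Finset ℕ) := by decide +kernel

lemma gen_vec (p q : B6) (f : (Fin 4 → ZMod 2) → ZMod 2) (hf : f ∈ Code p q) :
    ∃ x y z w b s t : ZMod 2, f = gen p q (![x, y, z, w], b, s, t) := by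
  obtain ⟨⟨a, b, s, t⟩, rfl⟩ := hf
  have hv : a = ![a 0, a 1, a 2, a 3] := by funext i; fin_cases i <;> rfl
  exact ⟨a 0, a 1, a 2, a 3, b, s, t, by rw [← hv]⟩

lemma exA : ∀ n ∈ ({0, 6, 8, 10, 16} : Finset ℕ), ∃ (x y z w b s t : ZMod 2),
    wt (gen pA qA (![x, y, z, w], b, s, t)) = n := by decide +kernel

lemma exB : ∀ n ∈ ({0, 4, 8, 12, 16} : Finset ℕ), ∃ (x y z w b s t : ZMod 2),
    wt (gen pB qB (![x, y, z, w], b, s, t)) = n := by decide +kernel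

lemma weightsA : {w : ℕ | ∃ x ∈ Code pA qA, wt x = w} = ({0, 6, 8, 10, 16} : Set ℕ) := by
  ext n
  constructor
  · rintro ⟨f, hf, rfl⟩
    obtain ⟨x, y, z, w, b, s, t, rfl⟩ := gen_vec _ _ f hf
    simpa using wtA x y z w b s t
  · intro hn
    obtain ⟨x, y, z, w, b, s, t, h⟩ := exA n (by simpa using hn)
    exact ⟨_, ⟨_, rfl⟩, h⟩

lemma weightsB : {w : ℕ | ∃ x ∈ Code pB qB, wt x = w} = ({0, 4, 8, 12, 16} : Set ℕ) := by
  ext n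
  constructor
  · rintro ⟨f, hf, rfl⟩
    obtain ⟨x, y, z, w, b, s, t, rfl⟩ := gen_vec _ _ f hf
    simpa using wtB x y z w b s t
  · intro hn
    obtain ⟨x, y, z, w, b, s, t, h⟩ := exB n (by simpa using hn)
    exact ⟨_, ⟨_, rfl⟩, h⟩

lemma satA : SatCond 4 7 2 (Code pA qA) := by
  refine ⟨finrank_Code _ _ (by decide) (by decide) (by decide), by norm_num, by norm_num, ?_,
    RM1_sub _ _⟩
  rw [weightsA]; norm_num

lemma satB : SatCond 4 7 4 (Code pB qB) := by
  refine ⟨finrank_Code _ _ (by decide) (by decide) (by decide), by norm_num, by norm_num, ?_,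
    RM1_sub _ _⟩
  rw [weightsB]; norm_num

lemma wt_zero_iff {f : (Fin 4 → ZMod 2) → ZMod 2} : wt f = 0 ↔ f = 0 := by
  rw [wt, Finset.card_eq_zero, Finset.filter_eq_empty_iff]
  constructor
  · intro h; funext v; simpa using @h v (Finset.mem_univ v)
  · rintro rfl; simp

lemma dmin_of (C : Submodule (ZMod 2) ((Fin 4 → ZMod 2) → ZMod 2)) (n r : ℕ) (h0 : 0 < n)
    (h1 : n ≤ 8) (h2 : n ≤ r) (h : {w : ℕ | ∃ x ∈ C, wt x = w} = ({0, n, 8, r, 16} : Set ℕ)) :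
    dmin (C : Set ((Fin 4 → ZMod 2) → ZMod 2)) = n := by
  have hn : n ∈ {w : ℕ | ∃ x ∈ C, wt x = w} := by rw [h]; simp
  obtain ⟨x, hx, hxn⟩ := hn
  have hx0 : x ≠ 0 := by
    intro h'; rw [wt_zero_iff.2 h'] at hxn; omega
  apply le_antisymm
  · exact Nat.sInf_le ⟨x, hx, hx0, hxn⟩
  · refine le_csInf (s := {w : ℕ | ∃ x ∈ C, x ≠ 0 ∧ wt x = w}) ⟨n, x, hx, hx0, hxn⟩ ?_
    rintro m ⟨y, hy, hy0, rfl⟩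
    have hm : wt y ∈ {w : ℕ | ∃ x ∈ C, wt x = w} := ⟨y, hy, rfl⟩
    rw [h] at hm
    have : wt y ≠ 0 := fun h' => hy0 (wt_zero_iff.1 h')
    simp only [Set.mem_insert_iff, Set.mem_singleton_iff] at hm
    omega

lemma wt_comp (f : (Fin 4 → ZMod 2) → ZMod 2) (s : Equiv.Perm (Fin 4 → ZMod 2)) :
    wt (f ∘ s) = wt f := by
  simp only [wt, Finset.card_filter]
  exact Equiv.sum_comp s (fun v => if f v ≠ 0 then 1 else 0)

/-- Normalizing evaluation map. -/
def evl : ((Fin 4 → ZMod 2) → ZMod 2) →ₗ[ZMod 2] (Fin 5 → ZMod 2) :=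
  LinearMap.funLeft (ZMod 2) (ZMod 2)
    ![![0,0,0,0], ![1,0,0,0], ![0,1,0,0], ![0,0,1,0], ![0,0,0,1]]

lemma exists_pair (C : Submodule (ZMod 2) ((Fin 4 → ZMod 2) → ZMod 2))
    (h : Module.finrank (ZMod 2) C = 7) :
    ∃ f ∈ C, ∃ g ∈ C, f ≠ 0 ∧ g ≠ 0 ∧ f + g ≠ 0 ∧ evl f = 0 ∧ evl g = 0 := by
  have hr := LinearMap.finrank_range_add_finrank_ker (evl.domRestrict C)
  have hle : Module.finrank (ZMod 2) (LinearMap.range (evl.domRestrict C)) ≤ 5 := by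
    simpa using Submodule.finrank_le (LinearMap.range (evl.domRestrict C))
  have h2 : 2 ≤ Module.finrank (ZMod 2) (LinearMap.ker (evl.domRestrict C)) := by omega
  obtain ⟨b, hb⟩ := exists_linearIndependent_of_le_finrank h2
  have hne := LinearIndependent.pair_iff.1 (show LinearIndependent (ZMod 2) ![b 0, b 1] by
    convert hb using 1; funext i; fin_cases i <;> rfl)
  refine ⟨(b 0).1.1, (b 0).1.2, (b 1).1.1, (b 1).1.2, ?_, ?_, ?_, (b 0).2, (b 1).2⟩
  · intro h0
    have := hne 1 0 (by apply Subtype.ext; apply Subtype.ext; simpa using h0)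
    exact absurd this.1 (by decide)
  · intro h0
    have := hne 0 1 (by apply Subtype.ext; apply Subtype.ext; simpa using h0)
    exact absurd this.2 (by decide)
  · intro h0
    have := hne 1 1 (by apply Subtype.ext; apply Subtype.ext; simpa using h0)
    exact absurd this.1 (by decide)

lemma nz_of (p : B6) (h : Qf p ≠ 0) : nz p = true := by
  by_contra hn
  apply h
  simp only [nz, Bool.not_eq_true, Bool.or_eq_false_iff] at hn
  obtain ⟨⟨⟨⟨⟨z1, z2⟩, z3⟩, z4⟩, z5⟩, z6⟩ := hn
  funext v
  simp [Qf, Qs, z1, z2, z3, z4, z5, z6, zb]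

lemma Qf_inj (p q : B6) (h : Qf p = Qf q) : p = q := by
  have hz : ∀ x y, zb x = zb y → x = y := by decide
  obtain ⟨p1, p2, p3, p4, p5, p6⟩ := p
  obtain ⟨q1, q2, q3, q4, q5, q6⟩ := q
  have e1 := congrFun h ![1,1,0,0]
  have e2 := congrFun h ![1,0,1,0]
  have e3 := congrFun h ![1,0,0,1]
  have e4 := congrFun h ![0,1,1,0]
  have e5 := congrFun h ![0,1,0,1]
  have e6 := congrFun h ![0,0,1,1]
  simp [Qf, Qs] at e1 e2 e3 e4 e5 e6
  rw [hz _ _ e1, hz _ _ e2, hz _ _ e3, hz _ _ e4, hz _ _ e5, hz _ _ e6]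

lemma ne_of_nz (p : B6) (h : nz p = true) : p ≠ (false, false, false, false, false, false) := by
  rintro rfl; exact absurd h (by decide)

/-- up to equivalence there exist exactly two binary `[16,7]`
codes satisfying (C1) and (C2), one of minimum weight 6 and one of minimum
weight 4. -/
theorem stmt12 :
    ∃ (C₁ C₂ : Submodule (ZMod 2) ((Fin 4 → ZMod 2) → ZMod 2)) (a₁ a₂ : ℕ),
      SatCond 4 7 a₁ C₁ ∧ SatCond 4 7 a₂ C₂ ∧
      dmin (↑C₁ : Set ((Fin 4 → ZMod 2) → ZMod 2)) = 6 ∧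
      dmin (↑C₂ : Set ((Fin 4 → ZMod 2) → ZMod 2)) = 4 ∧
      ¬ CodeEquiv (↑C₁ : Set ((Fin 4 → ZMod 2) → ZMod 2)) (↑C₂) ∧
      ∀ (C : Submodule (ZMod 2) ((Fin 4 → ZMod 2) → ZMod 2)) (a : ℕ),
        SatCond 4 7 a C →
        CodeEquiv (↑C : Set ((Fin 4 → ZMod 2) → ZMod 2)) (↑C₁) ∨
        CodeEquiv (↑C : Set ((Fin 4 → ZMod 2) → ZMod 2)) (↑C₂) := by
  refine ⟨Code pA qA, Code pB qB, 2, 4, satA, satB, dmin_of _ 6 10 (by norm_num) (by norm_num)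
    (by norm_num) weightsA, dmin_of _ 4 12 (by norm_num) (by norm_num) (by norm_num) weightsB,
    ?_, ?_⟩
  · rintro ⟨s, hs⟩
    have h4 : 4 ∈ {w : ℕ | ∃ x ∈ Code pB qB, wt x = w} := by rw [weightsB]; simp
    obtain ⟨x, hx, hx4⟩ := h4
    rw [← SetLike.mem_coe, hs] at hx
    obtain ⟨y, hy, rfl⟩ := hx
    have hm : 4 ∈ {w : ℕ | ∃ x ∈ Code pA qA, wt x = w} := ⟨y, hy, (wt_comp y s).symm.trans hx4⟩
    rw [weightsA] at hm
    simp at hm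
  · intro C k hC
    obtain ⟨f, hf, g, hg, hf0, hg0, hfg, ef, eg⟩ := exists_pair C hC.1
    obtain ⟨p, rfl, hp⟩ := normal_form k C hC f hf hf0 (congrFun ef 0) (congrFun ef 1)
      (congrFun ef 2) (congrFun ef 3) (congrFun ef 4)
    obtain ⟨q, rfl, hq⟩ := normal_form k C hC g hg hg0 (congrFun eg 0) (congrFun eg 1)
      (congrFun eg 2) (congrFun eg 3) (congrFun eg 4)
    have e : evl (Qf p + Qf q) = 0 := by rw [map_add, ef, eg, add_zero]
    obtain ⟨r, hr, hr'⟩ := normal_form k C hC _ (C.add_mem hf hg) hfg (congrFun e 0)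
      (congrFun e 1) (congrFun e 2) (congrFun e 3) (congrFun e 4)
    rw [← Qf_add] at hr hfg
    have hrr := Qf_inj _ _ hr
    subst hrr
    have np := nz_of _ hf0
    have nq := nz_of _ hg0
    have npq := nz_of _ hfg
    have hne : p ≠ q := by
      rintro rfl
      exact absurd npq (by simp [nz, addB])
    have hle : Code p q ≤ C := Code_le _ _ _ hC.2.2.2.2 hf hg
    have heq : Code p q = C := Submodule.eq_of_le_of_finrank_eq hle (by
      rw [hC.1, finrank_Code _ _ (ne_of_nz _ np) (ne_of_nz _ nq) hne])
    rw [← heq]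
    have h1 : pfB p = pfB q := by
      rcases hp with ⟨a, b⟩ | ⟨a, b⟩ <;> rcases hq with ⟨c, d⟩ | ⟨c, d⟩ <;> first | omega | rw [b, d]
    have h2 : pfB p = pfB (addB p q) := by
      rcases hp with ⟨a, b⟩ | ⟨a, b⟩ <;> rcases hr' with ⟨c, d⟩ | ⟨c, d⟩ <;> first | omega | rw [b, d]
    exact classify p q np nq npq h1 h2
end

section
/- There exist exactly two equivalence classes of binary [16,8] codes satisfying the conditions (C1) and (C2) (with m = 4, n = 16): there are two inequivalent [16,8] codes satisfying the conditions, and every [16,8] code satisfying the conditions is equivalent to one of them. Moreover, every [16,8] code satisfying the conditions is doubly even and self-dual, with minimum weight 4. -/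
open Finset

namespace Cls

abbrev H := Fin 4 → ZMod 2

def lin (a : H) (b : ZMod 2) : H → ZMod 2 := fun v => (∑ i, a i * v i) + b

lemma mem_RM1 (f : H → ZMod 2) : f ∈ RM1 4 ↔ ∃ a b, f = lin a b := Iff.rfl

lemma lin_mem (a b) : lin a b ∈ RM1 4 := ⟨a, b, rfl⟩

lemma lin_add (a a' b b') : lin a b + lin a' b' = lin (a + a') (b + b') := by
  funext v
  simp only [lin, Pi.add_apply, add_mul, Finset.sum_add_distrib]
  ring

lemma add_RM1 {f g : H → ZMod 2} (hf : f ∈ RM1 4) (hg : g ∈ RM1 4) : f + g ∈ RM1 4 := by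
  obtain ⟨a, b, rfl⟩ := hf
  obtain ⟨a', b', rfl⟩ := hg
  exact ⟨a + a', b + b', lin_add a a' b b'⟩

lemma add_self' (f : H → ZMod 2) : f + f = 0 := by
  funext v; exact CharTwo.add_self_eq_zero _

lemma add_cancel' (f g : H → ZMod 2) : f + (f + g) = g := by
  rw [← add_assoc, add_self', zero_add]

section weights
variable {ι : Type*} [Fintype ι]

lemma wt_eq_sum (x : ι → ZMod 2) : wt x = ∑ i, (x i).val := by
  unfold wt
  rw [Finset.card_filter]
  refine Finset.sum_congr rfl fun i _ => ?_
  generalize x i = t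
  revert t; decide

lemma wt_add (x y : ι → ZMod 2) : wt (x + y) + 2 * wt (x * y) = wt x + wt y := by
  simp only [wt_eq_sum, Finset.mul_sum, ← Finset.sum_add_distrib]
  refine Finset.sum_congr rfl fun i _ => ?_
  simp only [Pi.add_apply, Pi.mul_apply]
  generalize x i = t
  generalize y i = u
  revert t u; decide

lemma wt_cast (x : ι → ZMod 2) : ((wt x : ℕ) : ZMod 2) = ∑ i, x i := by
  rw [wt_eq_sum]; push_cast
  refine Finset.sum_congr rfl fun i _ => ?_
  simp

lemma wt_zero_iff (x : ι → ZMod 2) : wt x = 0 ↔ x = 0 := by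
  unfold wt
  rw [Finset.card_eq_zero, Finset.filter_eq_empty_iff]
  simp [funext_iff]

lemma wt_comp (x : ι → ZMod 2) (σ : Equiv.Perm ι) : wt (x ∘ σ) = wt x := by
  simp only [wt_eq_sum, Function.comp]
  exact Equiv.sum_comp σ (fun i => (x i).val)
end weights

lemma wt_full (x : H → ZMod 2) (h : wt x = 16) : x = lin 0 1 := by
  have h1 : (Finset.univ.filter fun i => x i ≠ 0) = Finset.univ := by
    apply Finset.eq_univ_of_card
    exact h
  funext v
  have : v ∈ (Finset.univ.filter fun i => x i ≠ 0) := by rw [h1]; simp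
  have h2 : x v ≠ 0 := by simpa using this
  simp only [lin, Pi.zero_apply, zero_mul, Finset.sum_const_zero, zero_add]
  generalize x v = t at h2
  revert t; decide

/-- sign character -/
def sg (t : ZMod 2) : ℤ := 1 - 2 * (t.val : ℤ)

lemma sg_add : ∀ s t : ZMod 2, sg (s + t) = sg s * sg t := by decide
lemma sg_sq : ∀ s : ZMod 2, sg s * sg s = 1 := by decide

lemma sum_sg (f : H → ZMod 2) : ∑ v, sg (f v) = 16 - 2 * (wt f : ℤ) := by
  simp only [sg, Finset.sum_sub_distrib, ← Finset.mul_sum, wt_eq_sum]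
  push_cast
  simp

lemma orth : ∀ u v : H, ∑ a : H, sg (lin a 0 u) * sg (lin a 0 v) = if u = v then 16 else 0 := by
  decide +kernel

lemma parseval (f : H → ZMod 2) : ∑ a : H, (16 - 2 * (wt (f + lin a 0) : ℤ)) ^ 2 = 256 := by
  have h1 : ∀ a : H, (16 - 2 * (wt (f + lin a 0) : ℤ)) ^ 2
      = ∑ u, ∑ v, (sg (f u) * sg (f v)) * (sg (lin a 0 u) * sg (lin a 0 v)) := by
    intro a
    rw [← sum_sg, sq, Finset.sum_mul_sum]
    refine Finset.sum_congr rfl fun u _ => Finset.sum_congr rfl fun v _ => ?_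
    simp only [Pi.add_apply, sg_add]; ring
  simp only [h1]
  rw [Finset.sum_comm]
  have h2 : ∀ u : H, ∑ a : H, ∑ v, (sg (f u) * sg (f v)) * (sg (lin a 0 u) * sg (lin a 0 v)) = 16 := by
    intro u
    rw [Finset.sum_comm]
    simp only [← Finset.mul_sum, orth]
    simp [sg_sq]
  simp only [h2]
  simp

variable {C : Submodule (ZMod 2) (H → ZMod 2)} {a : ℕ}

lemma sat_wt (h : SatCond 4 8 a C) {x : H → ZMod 2} (hx : x ∈ C) :
    wt x = 0 ∨ wt x = 8 - a ∨ wt x = 8 ∨ wt x = 8 + a ∨ wt x = 16 := by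
  obtain ⟨-, -, -, h, -⟩ := h
  have : wt x ∈ {w : ℕ | ∃ x ∈ C, wt x = w} := ⟨x, hx, rfl⟩
  rw [h] at this
  simpa using this

lemma sat_wt' (h : SatCond 4 8 a C) {x : H → ZMod 2} (hx : x ∈ C) (hn : x ∉ RM1 4) :
    wt x = 8 - a ∨ wt x = 8 ∨ wt x = 8 + a := by
  rcases sat_wt h hx with h1 | h1 | h1 | h1 | h1
  · exfalso; apply hn
    rw [wt_zero_iff] at h1; subst h1
    exact ⟨0, 0, by funext v; simp⟩
  · tauto
  · tauto
  · tauto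
  · exfalso; apply hn; rw [wt_full x h1]; exact lin_mem _ _

lemma sat_RM1 (h : SatCond 4 8 a C) {x : H → ZMod 2} (hx : x ∈ RM1 4) : x ∈ C :=
  h.2.2.2.2 hx

lemma not_RM1_add {f g : H → ZMod 2} (hf : f ∉ RM1 4) (hg : g ∈ RM1 4) : f + g ∉ RM1 4 := by
  intro h
  apply hf
  have := add_RM1 hg h
  rwa [add_comm f g, add_cancel'] at this

lemma a_cases (h : SatCond 4 8 a C) {x : H → ZMod 2} (hx : x ∈ C) (hn : x ∉ RM1 4) :
    a = 4 ∨ (a = 2 ∧ wt x ≠ 8) := by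
  have ha : 0 < a := h.2.1
  have ha' : a < 8 := h.2.2.1
  have key : ∀ c : H, (16 - 2 * (wt (x + lin c 0) : ℤ)) ^ 2
      = if wt (x + lin c 0) ≠ 8 then 4 * (a : ℤ) ^ 2 else 0 := by
    intro c
    rcases sat_wt' h (C.add_mem hx (sat_RM1 h (lin_mem c 0))) (not_RM1_add hn (lin_mem c 0))
      with h1 | h1 | h1
    · rw [if_pos (by omega), h1]; push_cast [ha'.le]; ring
    · rw [if_neg (by omega), h1]; norm_num
    · rw [if_pos (by omega), h1]; push_cast; ring
  have hp := parseval x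
  simp only [key] at hp
  rw [← Finset.sum_filter, Finset.sum_const, nsmul_eq_mul] at hp
  set S := (Finset.univ.filter fun c : H => wt (x + lin c 0) ≠ 8) with hS
  have hc : S.card ≤ 16 := (Finset.card_le_univ S).trans (by simp)
  have hp' : S.card * (4 * a ^ 2) = 256 := by exact_mod_cast hp
  have h0 : wt x ≠ 8 ∨ wt x = 8 := by tauto
  interval_cases a <;> try omega
  right
  refine ⟨rfl, ?_⟩
  have h16 : S.card = 16 := by omega
  have hu : S = Finset.univ := by
    apply Finset.eq_univ_of_card
    rw [h16]; simp
  have h3 : (0 : H) ∈ S := by rw [hu]; simp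
  have h4 : lin 0 0 = 0 := by funext v; simp [lin]
  rw [hS, Finset.mem_filter, h4, add_zero] at h3
  exact h3.2

lemma card_C (h : Module.finrank (ZMod 2) C = 8) : Nat.card C = 256 := by
  rw [Module.natCard_eq_pow_finrank (K := ZMod 2) (V := C), h]; simp

/-- translates of RM1 as finset -/
def cos (f : H → ZMod 2) : Finset (H → ZMod 2) :=
  (Finset.univ : Finset (H × ZMod 2)).image fun q => f + lin q.1 q.2

lemma mem_cos {f g : H → ZMod 2} (h : f + g ∈ RM1 4) : g ∈ cos f := by
  obtain ⟨a, b, h⟩ := h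
  refine Finset.mem_image.2 ⟨(a, b), Finset.mem_univ _, ?_⟩
  show f + lin a b = g
  rw [← show f + g = lin a b from h, add_cancel']

lemma card_cos (f) : (cos f).card ≤ 32 :=
  Finset.card_image_le.trans (by simp)

lemma exists_avoid (h : Module.finrank (ZMod 2) C = 8) (T : Finset (H → ZMod 2))
    (hT : T.card < 256) : ∃ x ∈ C, x ∉ T := by
  by_contra! hc
  have h1 : (C : Set (H → ZMod 2)).ncard ≤ (T : Set (H → ZMod 2)).ncard :=
    Set.ncard_le_ncard (fun x hx => hc x hx) (Finset.finite_toSet T)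
  rw [Set.ncard_coe_finset] at h1
  have := card_C h
  have h2 : (C : Set (H → ZMod 2)).ncard = Nat.card C := rfl
  omega

lemma exists_triple (h : Module.finrank (ZMod 2) C = 8) :
    ∃ x ∈ C, ∃ y ∈ C, ∃ z ∈ C, x ∉ RM1 4 ∧ y ∉ RM1 4 ∧ z ∉ RM1 4 ∧ x + y ∉ RM1 4 ∧
      x + z ∉ RM1 4 ∧ y + z ∉ RM1 4 ∧ x + y + z ∉ RM1 4 := by
  obtain ⟨x, hx, hx'⟩ := exists_avoid h (cos 0) (by have := card_cos 0; omega)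
  obtain ⟨y, hy, hy'⟩ := exists_avoid h (cos 0 ∪ cos x) (by
    have := card_cos 0; have := card_cos x
    have := Finset.card_union_le (cos 0) (cos x); omega)
  obtain ⟨z, hz, hz'⟩ := exists_avoid h ((cos 0 ∪ cos x) ∪ (cos y ∪ cos (x + y))) (by
    have := card_cos 0; have := card_cos x; have := card_cos y; have := card_cos (x + y)
    have := Finset.card_union_le (cos 0) (cos x)
    have := Finset.card_union_le (cos y) (cos (x + y))
    have := Finset.card_union_le (cos 0 ∪ cos x) (cos y ∪ cos (x + y)); omega)
  simp only [Finset.mem_union, not_or] at hy' hz'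
  have z0 : ∀ {f : H → ZMod 2}, f ∉ cos 0 → f ∉ RM1 4 := fun {f} hf hh =>
    hf (mem_cos (by rwa [zero_add]))
  exact ⟨x, hx, y, hy, z, hz, z0 hx', z0 hy'.1, z0 hz'.1.1, fun hh => hy'.2 (mem_cos hh),
    fun hh => hz'.1.2 (mem_cos hh), fun hh => hz'.2.1 (mem_cos hh), fun hh => hz'.2.2 (mem_cos hh)⟩

lemma a_eq (h : SatCond 4 8 a C) : a = 4 := by
  obtain ⟨x, hx, y, hy, z, hz, h1, h2, h3, h4, h5, h6, h7⟩ := exists_triple h.1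
  by_contra hne
  have key : ∀ f ∈ C, f ∉ RM1 4 → wt f % 4 = 2 := by
    intro f hf hn
    rcases a_cases h hf hn with h' | ⟨rfl, h'⟩
    · exact absurd h' hne
    · rcases sat_wt' h hf hn with h'' | h'' | h'' <;> omega
  have e1 := key x hx h1
  have e2 := key y hy h2
  have e3 := key z hz h3
  have e4 := key _ (C.add_mem hx hy) h4
  have e5 := key _ (C.add_mem hx hz) h5
  have e6 := key _ (C.add_mem hy hz) h6
  have e7 := key _ (C.add_mem (C.add_mem hx hy) hz) h7
  have f1 := wt_add x y
  have f2 := wt_add x z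
  have f3 := wt_add x (y + z)
  rw [← add_assoc] at f3
  have f4 := wt_add (x * y) (x * z)
  rw [← mul_add] at f4
  omega

lemma de (h : SatCond 4 8 a C) : ∀ x ∈ C, 4 ∣ wt x := by
  intro x hx
  have := a_eq h
  subst this
  rcases sat_wt h hx with h1 | h1 | h1 | h1 | h1 <;> omega

lemma self_orth (h : ∀ x ∈ C, 4 ∣ wt x) {x y : H → ZMod 2} (hx : x ∈ C) (hy : y ∈ C) :
    ∑ i, x i * y i = 0 := by
  have h1 := h x hx
  have h2 := h y hy
  have h3 := h _ (C.add_mem hx hy)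
  have h4 := wt_add x y
  have h5 : 2 ∣ wt (x * y) := by omega
  have h6 := wt_cast (x * y)
  rw [(ZMod.natCast_eq_zero_iff _ _).2 h5] at h6
  exact h6.symm

lemma self_dual (h : SatCond 4 8 a C) : dualCode C = C := by
  symm
  apply Submodule.eq_of_le_of_finrank_eq
  · intro x hx y hy
    exact self_orth (de h) hx hy
  · have hrefl : (Matrix.toBilin' (1 : Matrix H H (ZMod 2))).IsRefl := by
      intro x y hxy
      rw [Matrix.toBilin'_apply', Matrix.one_mulVec] at hxy ⊢
      rwa [dotProduct_comm]
    have h1 := LinearMap.BilinForm.finrank_orthogonal (K := ZMod 2) (V := H → ZMod 2)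
      (B := Matrix.toBilin' (1 : Matrix H H (ZMod 2)))
      (Matrix.nondegenerate_toBilin'_iff.2 (Matrix.nondegenerate_of_det_ne_zero (by simp)))
      C
    have h2 : (Matrix.toBilin' (1 : Matrix H H (ZMod 2))).orthogonal C = dualCode C := by
      ext x
      simp only [LinearMap.BilinForm.mem_orthogonal_iff,
        Matrix.toBilin'_apply', Matrix.one_mulVec]
      refine forall₂_congr fun y _ => ?_
      rw [dotProduct_comm]
      rfl
    rw [h2, h.1] at h1
    rw [h1, h.1]
    simp

lemma dmin_eq (h : SatCond 4 8 a C) : dmin (C : Set (H → ZMod 2)) = 4 := by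
  have ha := a_eq h
  subst ha
  have h4 : 4 ∈ {w : ℕ | ∃ x ∈ C, wt x = w} := by
    rw [h.2.2.2.1]; simp
  obtain ⟨x, hx, hw⟩ := h4
  unfold dmin
  apply le_antisymm
  · apply Nat.sInf_le
    refine ⟨x, hx, ?_, hw⟩
    rintro rfl
    have := (wt_zero_iff (0 : H → ZMod 2)).2 rfl
    omega
  · refine le_csInf ⟨4, x, hx, ?_, hw⟩ ?_
    · rintro rfl
      have := (wt_zero_iff (0 : H → ZMod 2)).2 rfl
      omega
    · rintro w ⟨y, hy, hy0, rfl⟩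
      have := de h y hy
      have : wt y ≠ 0 := fun hh => hy0 ((wt_zero_iff y).1 hh)
      omega

abbrev P := Fin 6 → ZMod 2

/-- quadratic form with coefficient vector `p`. -/
def Q (p : P) : H → ZMod 2 := fun v =>
  p 0 * (v 0 * v 1) + p 1 * (v 0 * v 2) + p 2 * (v 0 * v 3) + p 3 * (v 1 * v 2)
    + p 4 * (v 1 * v 3) + p 5 * (v 2 * v 3)

lemma Q_add (p q : P) : Q (p + q) = Q p + Q q := by
  funext v; simp only [Q, Pi.add_apply]; ring

lemma Q_zero : Q 0 = 0 := by
  funext v; simp [Q]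

def enc (p : P) : ℕ := (p 0).val + 2 * (p 1).val + 4 * (p 2).val + 8 * (p 3).val
  + 16 * (p 4).val + 32 * (p 5).val

lemma enc_lt : ∀ p : P, enc p < 64 := by decide +kernel

lemma enc_inj : ∀ p q : P, enc p = enc q → p = q := by decide +kernel

lemma enc_add : ∀ p q : P, enc (p + q) = enc p ^^^ enc q := by decide +kernel

def wedge (a b : H) : P :=
  ![a 0 * b 1 + a 1 * b 0, a 0 * b 2 + a 2 * b 0, a 0 * b 3 + a 3 * b 0,
    a 1 * b 2 + a 2 * b 1, a 1 * b 3 + a 3 * b 1, a 2 * b 3 + a 3 * b 2]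

lemma sq_id : ∀ t : ZMod 2, t * t = t := by decide

lemma prod_eq (a b : H) : (fun v : H => (∑ i, a i * v i) * (∑ i, b i * v i))
    = Q (wedge a b) + lin (a * b) 0 := by
  funext v
  simp only [Q, wedge, lin, Fin.sum_univ_four, Pi.add_apply, Pi.mul_apply]
  simp only [Matrix.cons_val]
  linear_combination a 0 * b 0 * sq_id (v 0) + a 1 * b 1 * sq_id (v 1) + a 2 * b 2 * sq_id (v 2)
    + a 3 * b 3 * sq_id (v 3)

def row (m j : ℕ) : H := fun i => if m.testBit (4 * j + i) then 1 else 0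

def hm (m : ℕ) (v : H) : H := fun j => ∑ i, row m j i * v i

def L0 : List (ℕ × ℕ × ℕ × ℕ) :=
  [(33825, 1, 2, 4), (33810, 1, 8, 16), (33811, 1, 10, 20), (33300, 2, 8, 32), (33301, 2, 9, 36),
   (33302, 3, 8, 48), (33303, 3, 9, 52), (16920, 4, 16, 32), (16921, 4, 17, 34), (16922, 5, 16, 40),
   (16923, 5, 17, 42), (16924, 6, 24, 32), (16925, 6, 25, 34), (16926, 7, 24, 40),
   (16927, 7, 25, 42)]

def L1 : List (ℕ × ℕ × ℕ × ℕ) :=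
  [(33825, 1, 2, 8), (18465, 1, 4, 16), (19489, 1, 6, 24), (10305, 2, 4, 32), (10817, 2, 5, 40),
   (10337, 3, 4, 48), (10849, 3, 5, 56), (6210, 8, 16, 32), (6466, 8, 17, 34), (6226, 9, 16, 36),
   (6482, 9, 17, 38), (6211, 10, 20, 32), (6467, 10, 21, 34), (6227, 11, 20, 36),
   (6483, 11, 21, 38)]

lemma L0_ok : ∀ e ∈ L0, (∀ v, hm e.1 v = 0 → v = 0) ∧
    enc (wedge (row e.1 0) (row e.1 1)) = e.2.1 ∧
    enc (wedge (row e.1 0) (row e.1 2)) = e.2.2.1 ∧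
    enc (wedge (row e.1 0) (row e.1 3)) = e.2.2.2 := by decide +kernel

lemma L1_ok : ∀ e ∈ L1, (∀ v, hm e.1 v = 0 → v = 0) ∧
    enc (wedge (row e.1 0) (row e.1 1)) = e.2.1 ∧
    enc (wedge (row e.1 0) (row e.1 2)) = e.2.2.1 ∧
    enc (wedge (row e.1 1) (row e.1 2)) = e.2.2.2 := by decide +kernel

def sp (x y z : ℕ) : List ℕ := [x, y, z, x ^^^ y, x ^^^ z, y ^^^ z, x ^^^ y ^^^ z]

def tb (M w : ℕ) : Bool := Nat.beq (Nat.land 1 (Nat.shiftRight M w)) 1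

lemma tb_eq (M w : ℕ) : tb M w = M.testBit w := by
  show Nat.beq (1 &&& (M >>> w)) 1 = _
  rw [Nat.testBit, Nat.one_and_eq_mod_two]
  rcases Nat.mod_two_eq_zero_or_one (M >>> w) with h | h <;> rw [h] <;> rfl

def bt (x : ℕ) : ℕ := Nat.shiftLeft 1 x

/-- bit mask of the nonzero elements of the span -/
def mask (x y z : ℕ) : ℕ :=
  Nat.lor (bt x) (Nat.lor (bt y) (Nat.lor (bt z) (Nat.lor (bt (Nat.xor x y))
    (Nat.lor (bt (Nat.xor x z)) (Nat.lor (bt (Nat.xor y z)) (bt (Nat.xor (Nat.xor x y) z)))))))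

lemma tb_bt (x w : ℕ) : (bt x).testBit w = true ↔ w = x := by
  have h : bt x = 1 <<< x := rfl
  rw [h, Nat.shiftLeft_eq, one_mul, Nat.testBit_two_pow]
  simp [eq_comm]

lemma mem_of_tb {x y z w : ℕ} (h : tb (mask x y z) w = true) : w ∈ sp x y z := by
  have e : mask x y z = bt x ||| (bt y ||| (bt z ||| (bt (x ^^^ y) ||| (bt (x ^^^ z) |||
    (bt (y ^^^ z) ||| bt (x ^^^ y ^^^ z)))))) := rfl
  rw [tb_eq, e] at h
  simp only [Nat.testBit_or, Bool.or_eq_true, tb_bt] at h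
  simp only [sp, List.mem_cons, List.not_mem_nil, or_false]
  exact h

def goodM (M : ℕ) : Bool :=
  (L0.any fun e => tb M e.2.1 && (tb M e.2.2.1 && tb M e.2.2.2)) ||
  (L1.any fun e => tb M e.2.1 && (tb M e.2.2.1 && tb M e.2.2.2))

def good (x y z : ℕ) : Bool := goodM (mask x y z)

def ok (x : ℕ) : Bool := tb 7609294833184870398 x

lemma ok_of : ∀ p : P, 4 ∣ wt (Q p) → p ≠ 0 → ok (enc p) = true := by decide +kernel

def coreCheck : Bool :=
  (List.range 64).all fun x => !ok x || (List.range 64).all fun y =>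
    !(ok y && ok (Nat.xor x y)) || (List.range 64).all fun z =>
      !(ok z && ok (Nat.xor x z) && ok (Nat.xor y z) && ok (Nat.xor (Nat.xor x y) z)) || good x y z

lemma coreCheck_true : coreCheck = true := by decide +kernel

lemma imp_of {s t : Bool} (h : (!s || t) = true) (hs : s = true) : t = true := by
  subst hs; exact h

lemma core_bool (x : ℕ) (hx : x < 64) (h1 : ok x = true) (y : ℕ) (hy : y < 64)
    (h2 : (ok y && ok (x ^^^ y)) = true) (z : ℕ) (hz : z < 64)
    (h3 : (ok z && ok (x ^^^ z) && ok (y ^^^ z) && ok (x ^^^ y ^^^ z)) = true) :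
    good x y z = true := by
  have h := coreCheck_true
  unfold coreCheck at h
  have hX := List.all_eq_true.1 h x (List.mem_range.2 hx)
  replace hX := imp_of hX h1
  have hY := List.all_eq_true.1 hX y (List.mem_range.2 hy)
  replace hY := imp_of hY h2
  have hZ := List.all_eq_true.1 hY z (List.mem_range.2 hz)
  replace hZ := imp_of hZ h3
  exact hZ

lemma core {x y z : ℕ} (hx : x < 64) (hy : y < 64) (hz : z < 64) (h1 : ok x = true)
    (h2 : ok y = true) (h3 : ok z = true) (h4 : ok (x ^^^ y) = true) (h5 : ok (x ^^^ z) = true)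
    (h6 : ok (y ^^^ z) = true) (h7 : ok (x ^^^ y ^^^ z) = true) :
    (∃ e ∈ L0, e.2.1 ∈ sp x y z ∧ e.2.2.1 ∈ sp x y z ∧ e.2.2.2 ∈ sp x y z) ∨
    (∃ e ∈ L1, e.2.1 ∈ sp x y z ∧ e.2.2.1 ∈ sp x y z ∧ e.2.2.2 ∈ sp x y z) := by
  have h := core_bool x hx h1 y hy (by simp [h2, h4]) z hz (by simp [h3, h5, h6, h7])
  unfold good goodM at h
  simp only [Bool.or_eq_true, List.any_eq_true, Bool.and_eq_true] at h
  rcases h with ⟨e, he, w1, w2, w3⟩ | ⟨e, he, w1, w2, w3⟩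
  · exact Or.inl ⟨e, he, mem_of_tb w1, mem_of_tb w2, mem_of_tb w3⟩
  · exact Or.inr ⟨e, he, mem_of_tb w1, mem_of_tb w2, mem_of_tb w3⟩

lemma univ_H : (Finset.univ : Finset H) =
    {![0,0,0,0], ![1,0,0,0], ![0,1,0,0], ![1,1,0,0], ![0,0,1,0], ![1,0,1,0], ![0,1,1,0], ![1,1,1,0],
     ![0,0,0,1], ![1,0,0,1], ![0,1,0,1], ![1,1,0,1], ![0,0,1,1], ![1,0,1,1], ![0,1,1,1],
     ![1,1,1,1]} := by decide +kernel

lemma sum_H (F : H → ZMod 2) : ∑ v, F v =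
    F ![0,0,0,0] + (F ![1,0,0,0] + (F ![0,1,0,0] + (F ![1,1,0,0] + (F ![0,0,1,0] + (F ![1,0,1,0]
     + (F ![0,1,1,0] + (F ![1,1,1,0] + (F ![0,0,0,1] + (F ![1,0,0,1] + (F ![0,1,0,1]
     + (F ![1,1,0,1] + (F ![0,0,1,1] + (F ![1,0,1,1] + (F ![0,1,1,1]
     + F ![1,1,1,1])))))))))))))) := by
  rw [univ_H]
  repeat rw [Finset.sum_insert (by decide +kernel)]
  rw [Finset.sum_singleton]

lemma two0 : (2 : ZMod 2) = 0 := rfl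

lemma forall_H (p : H → Prop) (h : ∀ v ∈ (Finset.univ : Finset H), p v) : ∀ v, p v :=
  fun v => h v (Finset.mem_univ v)

lemma quad (f : H → ZMod 2) (hf : ∀ g ∈ RM1 4, ∑ v, f v * g v = 0) :
    ∃ p, f + Q p ∈ RM1 4 := by
  have o := hf _ (lin_mem 0 1)
  have o0 := hf _ (lin_mem ![1,0,0,0] 1)
  have o1 := hf _ (lin_mem ![0,1,0,0] 1)
  have o2 := hf _ (lin_mem ![0,0,1,0] 1)
  have o3 := hf _ (lin_mem ![0,0,0,1] 1)
  rw [sum_H] at o o0 o1 o2 o3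
  have e11 : (1 + 1 : ZMod 2) = 0 := rfl
  simp [lin, Fin.sum_univ_four, e11] at o o0 o1 o2 o3
  refine ⟨![f ![0,0,0,0] + f ![1,0,0,0] + f ![0,1,0,0] + f ![1,1,0,0],
    f ![0,0,0,0] + f ![1,0,0,0] + f ![0,0,1,0] + f ![1,0,1,0],
    f ![0,0,0,0] + f ![1,0,0,0] + f ![0,0,0,1] + f ![1,0,0,1],
    f ![0,0,0,0] + f ![0,1,0,0] + f ![0,0,1,0] + f ![0,1,1,0],
    f ![0,0,0,0] + f ![0,1,0,0] + f ![0,0,0,1] + f ![0,1,0,1],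
    f ![0,0,0,0] + f ![0,0,1,0] + f ![0,0,0,1] + f ![0,0,1,1]],
    ![f ![0,0,0,0] + f ![1,0,0,0], f ![0,0,0,0] + f ![0,1,0,0], f ![0,0,0,0] + f ![0,0,1,0],
      f ![0,0,0,0] + f ![0,0,0,1]], f ![0,0,0,0], ?_⟩
  funext v
  revert v
  apply forall_H
  rw [univ_H]
  simp only [Finset.mem_insert, Finset.mem_singleton, forall_eq_or_imp, forall_eq]
  simp [Q, Fin.sum_univ_four]
  generalize f ![0,0,0,0] = x0 at *
  generalize f ![1,0,0,0] = x1 at *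
  generalize f ![0,1,0,0] = x2 at *
  generalize f ![1,1,0,0] = x3 at *
  generalize f ![0,0,1,0] = x4 at *
  generalize f ![1,0,1,0] = x5 at *
  generalize f ![0,1,1,0] = x6 at *
  generalize f ![1,1,1,0] = x7 at *
  generalize f ![0,0,0,1] = x8 at *
  generalize f ![1,0,0,1] = x9 at *
  generalize f ![0,1,0,1] = x10 at *
  generalize f ![1,1,0,1] = x11 at *
  generalize f ![0,0,1,1] = x12 at *
  generalize f ![1,0,1,1] = x13 at *
  generalize f ![0,1,1,1] = x14 at *
  generalize f ![1,1,1,1] = x15 at *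
  clear hf e11
  refine ⟨?_, ?_, ?_, ?_, ?_, ?_, ?_, ?_, ?_, ?_, ?_, ?_, ?_, ?_, ?_⟩ <;> grind

/-- the code generated by `RM(1,4)` and three more words -/
def genMap (m : Fin 3 → H → ZMod 2) : (H × ZMod 2 × (Fin 3 → ZMod 2)) →ₗ[ZMod 2] (H → ZMod 2) where
  toFun t := fun v => (∑ i, t.1 i * v i) + t.2.1 + ∑ j, t.2.2 j * m j v
  map_add' s t := by
    funext v
    simp only [Prod.fst_add, Prod.snd_add, Pi.add_apply, add_mul, Finset.sum_add_distrib]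
    ring
  map_smul' c t := by
    funext v
    simp only [Prod.smul_fst, Prod.smul_snd, Pi.smul_apply, smul_eq_mul, RingHom.id_apply,
      mul_assoc, ← Finset.mul_sum]
    ring

def m1 : Fin 3 → H → ZMod 2 := ![fun v => v 0 * v 1, fun v => v 0 * v 2, fun v => v 0 * v 3]
def m2 : Fin 3 → H → ZMod 2 := ![fun v => v 0 * v 1, fun v => v 0 * v 2, fun v => v 1 * v 2]

def Code (m : Fin 3 → H → ZMod 2) : Submodule (ZMod 2) (H → ZMod 2) := LinearMap.range (genMap m)

lemma ker1 : ∀ t, genMap m1 t = 0 → t = 0 := by decide +kernel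
lemma ker2 : ∀ t, genMap m2 t = 0 → t = 0 := by decide +kernel

lemma wts1 : ∀ t, wt (genMap m1 t) ∈ [0, 4, 8, 12, 16] := by decide +kernel
lemma wts2 : ∀ t, wt (genMap m2 t) ∈ [0, 4, 8, 12, 16] := by decide +kernel

lemma finrank_code {m} (h : ∀ t, genMap m t = 0 → t = 0) :
    Module.finrank (ZMod 2) (Code m) = 8 := by
  unfold Code
  rw [LinearMap.finrank_range_of_inj ((injective_iff_map_eq_zero (genMap m)).2 h)]
  simp

lemma RM1_code (m) : RM1 4 ⊆ (Code m : Set (H → ZMod 2)) := by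
  rintro f ⟨a, b, rfl⟩
  refine ⟨(a, b, 0), ?_⟩
  funext v
  simp [genMap]

lemma sat_code {m} (h : ∀ t, genMap m t = 0 → t = 0)
    (hw : ∀ t, wt (genMap m t) ∈ [0, 4, 8, 12, 16])
    (h0 : ∃ t, wt (genMap m t) = 0) (h4 : ∃ t, wt (genMap m t) = 4)
    (h8 : ∃ t, wt (genMap m t) = 8) (h12 : ∃ t, wt (genMap m t) = 12)
    (h16 : ∃ t, wt (genMap m t) = 16) : SatCond 4 8 4 (Code m) := by
  refine ⟨finrank_code h, by norm_num, by norm_num, ?_, RM1_code m⟩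
  ext w
  constructor
  · rintro ⟨_, ⟨t, rfl⟩, rfl⟩
    simpa using hw t
  · intro hh
    norm_num at hh
    have key : (∃ t, wt (genMap m t) = w) → w ∈ {w : ℕ | ∃ x ∈ Code m, wt x = w} := by
      rintro ⟨t, ht⟩
      exact ⟨_, ⟨t, rfl⟩, ht⟩
    rcases hh with rfl | rfl | rfl | rfl | rfl <;> apply key <;> assumption

lemma sat1 : SatCond 4 8 4 (Code m1) :=
  sat_code ker1 wts1 ⟨0, by decide +kernel⟩ ⟨(0, 0, ![1, 0, 0]), by decide +kernel⟩
    ⟨(![1, 0, 0, 0], 0, 0), by decide +kernel⟩ ⟨(0, 1, ![1, 0, 0]), by decide +kernel⟩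
    ⟨(0, 1, 0), by decide +kernel⟩

lemma sat2 : SatCond 4 8 4 (Code m2) :=
  sat_code ker2 wts2 ⟨0, by decide +kernel⟩ ⟨(0, 0, ![1, 0, 0]), by decide +kernel⟩
    ⟨(![1, 0, 0, 0], 0, 0), by decide +kernel⟩ ⟨(0, 1, ![1, 0, 0]), by decide +kernel⟩
    ⟨(0, 1, 0), by decide +kernel⟩

lemma sep2 : ∀ t, wt (genMap m2 t) = 4 →
    genMap m2 t ![0, 0, 0, 0] = genMap m2 t ![0, 0, 0, 1] := by decide +kernel

/-- the parameters of the weight four word `(v 0 + b) * (v (j+1) + c)` -/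
def par (j : Fin 3) (b c : ZMod 2) : H × ZMod 2 × (Fin 3 → ZMod 2) :=
  (Pi.single 0 c + Pi.single j.succ b, b * c, Pi.single j 1)

lemma par_wt : ∀ j b c, wt (genMap m1 (par j b c)) = 4 := by decide +kernel

lemma sep1 : ∀ u v : H, (∀ j b c, genMap m1 (par j b c) u = genMap m1 (par j b c) v) → u = v := by
  decide +kernel

lemma inequiv : ¬ CodeEquiv (Code m1 : Set (H → ZMod 2)) (Code m2 : Set (H → ZMod 2)) := by
  rintro ⟨σ, hσ⟩
  have h : σ ![0, 0, 0, 0] = σ ![0, 0, 0, 1] := by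
    apply sep1
    intro j b c
    have h1 : genMap m1 (par j b c) ∘ σ ∈ (Code m2 : Set (H → ZMod 2)) := by
      rw [hσ]
      exact ⟨_, ⟨_, rfl⟩, rfl⟩
    obtain ⟨t, ht⟩ := h1
    have h2 := sep2 t (by rw [ht, wt_comp, par_wt])
    rw [ht] at h2
    exact h2
  have := σ.injective h
  revert this
  decide

lemma hm_add (m : ℕ) (u v : H) : hm m (u + v) = hm m u + hm m v := by
  funext j
  simp only [hm, Pi.add_apply, mul_add, Finset.sum_add_distrib]

lemma hm_inj {m : ℕ} (h : ∀ v, hm m v = 0 → v = 0) : Function.Injective (hm m) := by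
  intro u v huv
  have h1 : hm m (u + v) = 0 := by
    rw [hm_add, huv]
    funext j; exact CharTwo.add_self_eq_zero _
  have h2 := h _ h1
  funext j
  have h3 : u j + v j = 0 := congrFun h2 j
  exact CharTwo.add_eq_zero.1 h3

lemma lin_hm (m : ℕ) (a : H) (b : ZMod 2) : (fun v => (∑ i, a i * hm m v i) + b) ∈ RM1 4 := by
  refine ⟨fun i => ∑ j, a j * row m j i, b, ?_⟩
  funext v
  congr 1
  simp only [hm, Finset.mul_sum, Finset.sum_mul]
  rw [Finset.sum_comm]
  refine Finset.sum_congr rfl fun i _ => Finset.sum_congr rfl fun j _ => ?_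
  ring

lemma equiv_of {m : ℕ} (hinj : ∀ v, hm m v = 0 → v = 0) (hR : RM1 4 ⊆ (C : Set (H → ZMod 2)))
    (hC : Module.finrank (ZMod 2) C = 8) {g : Fin 3 → H → ZMod 2}
    (hg : Module.finrank (ZMod 2) (Code g) = 8) (hgc : ∀ j, g j ∘ hm m ∈ C) :
    CodeEquiv (C : Set (H → ZMod 2)) (Code g : Set (H → ZMod 2)) := by
  let τ : Equiv.Perm H := Equiv.ofBijective (hm m) (Finite.injective_iff_bijective.1 (hm_inj hinj))
  have hinj' : Function.Injective (fun x : H → ZMod 2 => x ∘ τ) := τ.surjective.injective_comp_right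
  have hsub : (fun x : H → ZMod 2 => x ∘ τ) '' (Code g : Set (H → ZMod 2)) ⊆ C := by
    rintro _ ⟨_, ⟨t, rfl⟩, rfl⟩
    have e : genMap g t ∘ τ = (fun v => (∑ i, t.1 i * hm m v i) + t.2.1)
        + ∑ j, t.2.2 j • (g j ∘ hm m) := by
      funext v
      simp only [Pi.add_apply, Finset.sum_apply, Pi.smul_apply, smul_eq_mul]
      rfl
    show genMap g t ∘ τ ∈ C
    rw [e]
    exact C.add_mem (hR (lin_hm _ _ _)) (C.sum_mem fun j _ => C.smul_mem _ (hgc j))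
  have heq : (fun x : H → ZMod 2 => x ∘ τ) '' (Code g : Set (H → ZMod 2)) = C := by
    apply Set.eq_of_subset_of_ncard_le hsub _ (Set.toFinite _)
    rw [Set.ncard_image_of_injective _ hinj']
    have h1 : (C : Set (H → ZMod 2)).ncard = 256 := card_C hC
    have h2 : (Code g : Set (H → ZMod 2)).ncard = 256 := card_C hg
    omega
  refine ⟨τ.symm, ?_⟩
  rw [← heq, Set.image_image]
  have : ∀ x : H → ZMod 2, (x ∘ τ) ∘ τ.symm = x := by
    intro x; funext v; simp
  simp [this]

lemma classify (h : SatCond 4 8 a C) :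
    CodeEquiv (C : Set (H → ZMod 2)) (Code m1 : Set (H → ZMod 2)) ∨
    CodeEquiv (C : Set (H → ZMod 2)) (Code m2 : Set (H → ZMod 2)) := by
  have hR : RM1 4 ⊆ (C : Set (H → ZMod 2)) := h.2.2.2.2
  have hde := de h
  obtain ⟨x, hx, y, hy, z, hz, h1, h2, h3, h4, h5, h6, h7⟩ := exists_triple h.1
  obtain ⟨p, hp⟩ := quad x (fun g hg => self_orth hde hx (hR hg))
  obtain ⟨q, hq⟩ := quad y (fun g hg => self_orth hde hy (hR hg))
  obtain ⟨r, hr⟩ := quad z (fun g hg => self_orth hde hz (hR hg))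
  have base : ∀ {f p}, f ∈ C → f ∉ RM1 4 → f + Q p ∈ RM1 4 → Q p ∈ C ∧ ok (enc p) = true := by
    intro f p hf hn hp
    have hc : Q p ∈ C := by
      have := C.add_mem hf (hR hp)
      rwa [add_cancel'] at this
    refine ⟨hc, ok_of p (hde _ hc) ?_⟩
    intro this
    subst this
    rw [Q_zero, add_zero] at hp
    exact hn hp
  have hadd : ∀ {f g p q}, f + Q p ∈ RM1 4 → g + Q q ∈ RM1 4 → (f + g) + Q (p + q) ∈ RM1 4 := by
    intro f g p q hp hq
    have := add_RM1 hp hq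
    rwa [add_add_add_comm, ← Q_add] at this
  obtain ⟨c1, k1⟩ := base hx h1 hp
  obtain ⟨c2, k2⟩ := base hy h2 hq
  obtain ⟨c3, k3⟩ := base hz h3 hr
  obtain ⟨c4, k4⟩ := base (C.add_mem hx hy) h4 (hadd hp hq)
  obtain ⟨c5, k5⟩ := base (C.add_mem hx hz) h5 (hadd hp hr)
  obtain ⟨c6, k6⟩ := base (C.add_mem hy hz) h6 (hadd hq hr)
  obtain ⟨c7, k7⟩ := base (C.add_mem (C.add_mem hx hy) hz) h7 (hadd (hadd hp hq) hr)
  have hsp : ∀ s : P, enc s ∈ sp (enc p) (enc q) (enc r) → Q s ∈ C := by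
    intro s hs
    simp only [sp, List.mem_cons, List.not_mem_nil, or_false, ← enc_add] at hs
    rcases hs with hs | hs | hs | hs | hs | hs | hs <;> rw [enc_inj _ _ hs] <;> assumption
  have hprod : ∀ a b : H, enc (wedge a b) ∈ sp (enc p) (enc q) (enc r) →
      (fun v : H => (∑ i, a i * v i) * (∑ i, b i * v i)) ∈ C := by
    intro a b hab
    rw [prod_eq]
    exact C.add_mem (hsp _ hab) (hR (lin_mem _ _))
  simp only [enc_add] at k4 k5 k6 k7
  rcases core (enc_lt p) (enc_lt q) (enc_lt r) k1 k2 k3 k4 k5 k6 k7 with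
    ⟨e, he, w1, w2, w3⟩ | ⟨e, he, w1, w2, w3⟩
  · left
    obtain ⟨hi, v1, v2, v3⟩ := L0_ok e he
    rw [← v1] at w1; rw [← v2] at w2; rw [← v3] at w3
    refine equiv_of hi hR h.1 (finrank_code ker1) fun j => ?_
    fin_cases j
    · exact hprod _ _ w1
    · exact hprod _ _ w2
    · exact hprod _ _ w3
  · right
    obtain ⟨hi, v1, v2, v3⟩ := L1_ok e he
    rw [← v1] at w1; rw [← v2] at w2; rw [← v3] at w3
    refine equiv_of hi hR h.1 (finrank_code ker2) fun j => ?_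
    fin_cases j
    · exact hprod _ _ w1
    · exact hprod _ _ w2
    · exact hprod _ _ w3

end Cls

/-- up to equivalence there exist exactly two binary `[16,8]`
codes satisfying (C1) and (C2); moreover every such code is doubly even and
self-dual, with minimum weight 4. -/
theorem stmt13 :
    (∃ (C₁ C₂ : Submodule (ZMod 2) ((Fin 4 → ZMod 2) → ZMod 2)) (a₁ a₂ : ℕ),
      SatCond 4 8 a₁ C₁ ∧ SatCond 4 8 a₂ C₂ ∧
      ¬ CodeEquiv (↑C₁ : Set ((Fin 4 → ZMod 2) → ZMod 2)) (↑C₂) ∧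
      ∀ (C : Submodule (ZMod 2) ((Fin 4 → ZMod 2) → ZMod 2)) (a : ℕ),
        SatCond 4 8 a C →
        CodeEquiv (↑C : Set ((Fin 4 → ZMod 2) → ZMod 2)) (↑C₁) ∨
        CodeEquiv (↑C : Set ((Fin 4 → ZMod 2) → ZMod 2)) (↑C₂)) ∧
    ∀ (C : Submodule (ZMod 2) ((Fin 4 → ZMod 2) → ZMod 2)) (a : ℕ),
      SatCond 4 8 a C →
      (∀ x ∈ C, 4 ∣ wt x) ∧ dualCode C = C ∧
      dmin (↑C : Set ((Fin 4 → ZMod 2) → ZMod 2)) = 4 := by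
  exact ⟨⟨Cls.Code Cls.m1, Cls.Code Cls.m2, 4, 4, Cls.sat1, Cls.sat2, Cls.inequiv,
    fun _ _ h => Cls.classify h⟩, fun _ _ h => ⟨Cls.de h, Cls.self_dual h, Cls.dmin_eq h⟩⟩
end

section
/- There exists a set of 8 mutually quasi-unbiased weighing matrices for parameters (16, 16, 4, 64); that is, there exist 8 Hadamard matrices H_1, …, H_8 of order 16 such that for all i ≠ j the matrix (1/8) · H_i H_j^T has entries in {0, 1, −1} and is a weighing matrix of order 16 and weight 4. -/
open Finset

/-- Sign `(-1)^(number of binary digits 1 of n)` for `n < 16`. -/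
def sg (n : ℕ) : ℤ := 1 - 2 * (((n + n / 2 + n / 4 + n / 8) % 2 : ℕ) : ℤ)

/-- Character of `F_2^4`. -/
def chi (u x : Fin 16) : ℤ := sg (u.val &&& x.val)

/-- The quadratic sign `(-1)^(x_0 (r · x'))`, where `x = (x_0, x')`. -/
def qs (r : Fin 8) (x : Fin 16) : ℤ := sg ((x.val % 2) * (r.val &&& (x.val / 2)))

/-- Addition in `F_2^3`. -/
def xo (s t : Fin 8) : Fin 8 := ⟨s.val ^^^ t.val, Nat.xor_lt_two_pow (n := 3) s.2 t.2⟩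

def HH (s : Fin 8) : Matrix (Fin 16) (Fin 16) ℤ := fun u x => chi u x * qs s x

def WW (r : Fin 8) : Matrix (Fin 16) (Fin 16) ℤ := fun u v =>
  (if u.val / 2 = v.val / 2 then 1 else 0) +
  (if (u.val / 2) ^^^ (v.val / 2) = r.val then (if u.val % 2 = v.val % 2 then 1 else -1) else 0)

lemma qs_mul : ∀ (s t : Fin 8) (x : Fin 16), qs s x * qs t x = qs (xo s t) x := by
  decide +kernel

lemma xo_self : ∀ s : Fin 8, xo s s = 0 := by decide +kernel

lemma xo_ne : ∀ s t : Fin 8, s ≠ t → xo s t ≠ 0 := by decide +kernel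

lemma HH_entries : ∀ (s : Fin 8) (u x : Fin 16), HH s u x = 1 ∨ HH s u x = -1 := by
  unfold HH
  decide +kernel

lemma sum_H : ∀ (r : Fin 8) (u v : Fin 16),
    ∑ x, chi u x * chi v x * qs r x = 8 * WW r u v := by
  decide +kernel

lemma WW_entries : ∀ r : Fin 8, r ≠ 0 → ∀ u v : Fin 16,
    WW r u v = 0 ∨ WW r u v = 1 ∨ WW r u v = -1 := by
  unfold WW
  decide +kernel

lemma WW_mul : ∀ r : Fin 8, r ≠ 0 → ∀ u v : Fin 16,
    ∑ x, WW r u x * WW r v x = if u = v then 4 else 0 := by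
  decide +kernel

lemma WW_zero : ∀ u v : Fin 16, 8 * WW 0 u v = if u = v then 16 else 0 := by
  decide +kernel

lemma HH_mul (s t : Fin 8) : HH s * (HH t).transpose = (8 : ℤ) • WW (xo s t) := by
  ext u v
  rw [Matrix.mul_apply, Matrix.smul_apply, smul_eq_mul, ← sum_H]
  refine Finset.sum_congr rfl fun x _ => ?_
  rw [Matrix.transpose_apply, ← qs_mul]
  simp only [HH]
  ring

/-- there exist 8 mutually quasi-unbiased weighing matrices for
parameters `(16, 16, 4, 64)`. -/
theorem stmt14 :
    ∃ H : Fin 8 → Matrix (Fin 16) (Fin 16) ℤ,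
      (∀ i, IsHadamard 16 (H i)) ∧
      ∀ i j, i ≠ j →
        ∃ W : Matrix (Fin 16) (Fin 16) ℤ,
          IsWeighing 16 4 W ∧ H i * (H j).transpose = (8 : ℤ) • W := by
  refine ⟨HH, fun i => ⟨HH_entries i, ?_⟩, fun i j hij =>
    ⟨WW (xo i j), ⟨WW_entries _ (xo_ne i j hij), ?_⟩, HH_mul i j⟩⟩
  · rw [HH_mul, xo_self]
    ext u v
    rw [Matrix.smul_apply, smul_eq_mul, WW_zero, Matrix.smul_apply, Matrix.one_apply]
    split_ifs <;> simp
  · ext u v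
    rw [Matrix.mul_apply]
    simp only [Matrix.transpose_apply]
    rw [WW_mul _ (xo_ne i j hij), Matrix.smul_apply, Matrix.one_apply]
    split_ifs <;> simp
end

section
/- There exists a set of 4 mutually quasi-unbiased weighing matrices for parameters (16, 16, 16, 16); that is, there exist 4 Hadamard matrices H_1, …, H_4 of order 16 such that for all i ≠ j the matrix (1/4) · H_i H_j^T has entries in {1, −1} and is a Hadamard matrix of order 16. -/
open Finset

/-- Four quadratic forms on `F_2^4` whose pairwise differences are nondegenerate. -/
def quadForm (i x0 x1 x2 x3 : ℕ) : ℕ :=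
  (i % 2) * (x0 * x1 + x2 * x3) + (i / 2) * (x0 * x2 + x1 * x3 + x0 * x1)

/-- Exponent of the sign: quadratic form plus a linear form. -/
def signExp (i a x : ℕ) : ℕ :=
  quadForm i (x % 2) (x / 2 % 2) (x / 4 % 2) (x / 8 % 2)
    + (a % 2) * (x % 2) + (a / 2 % 2) * (x / 2 % 2)
    + (a / 4 % 2) * (x / 4 % 2) + (a / 8 % 2) * (x / 8 % 2)

/-- The four Hadamard matrices. -/
def kerH (i : Fin 4) : Matrix (Fin 16) (Fin 16) ℤ :=
  fun a x => 1 - 2 * ((signExp i a x % 2 : ℕ) : ℤ)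

lemma kerH_sign : ∀ (i : Fin 4) (a x : Fin 16), kerH i a x = 1 ∨ kerH i a x = -1 := by
  unfold kerH
  decide +kernel

lemma kerH_mul : ∀ i a b, ∑ x, kerH i a x * kerH i b x = if a = b then 16 else 0 := by
  decide +kernel

lemma kerH_cross : ∀ i j, i ≠ j → ∀ a b,
    ∑ x, kerH i a x * kerH j b x = 4 ∨ ∑ x, kerH i a x * kerH j b x = -4 := by
  decide +kernel

lemma kerH_mul_transpose (i : Fin 4) :
    kerH i * (kerH i).transpose = (16 : ℤ) • (1 : Matrix (Fin 16) (Fin 16) ℤ) := by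
  ext a b
  simp only [Matrix.mul_apply, Matrix.transpose_apply, kerH_mul, Matrix.smul_apply,
    Matrix.one_apply]
  split_ifs <;> simp

lemma kerH_transpose_mul (i : Fin 4) :
    (kerH i).transpose * kerH i = (16 : ℤ) • (1 : Matrix (Fin 16) (Fin 16) ℤ) := by
  ext a b
  simp only [Matrix.mul_apply, Matrix.transpose_apply, Matrix.smul_apply,
    Matrix.one_apply]
  revert i a b
  decide +kernel

/-- there exist 4 mutually quasi-unbiased weighing matrices for
parameters `(16, 16, 16, 16)`. -/
theorem stmt15 :
    ∃ H : Fin 4 → Matrix (Fin 16) (Fin 16) ℤ,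
      (∀ i, IsHadamard 16 (H i)) ∧
      ∀ i j, i ≠ j →
        ∃ K : Matrix (Fin 16) (Fin 16) ℤ,
          IsHadamard 16 K ∧ H i * (H j).transpose = (4 : ℤ) • K := by
  refine ⟨kerH, fun i => ⟨kerH_sign i, kerH_mul_transpose i⟩, fun i j hij => ?_⟩
  obtain ⟨K, hK⟩ : ∃ K : Matrix (Fin 16) (Fin 16) ℤ,
      ∀ a b, K a b = (∑ x, kerH i a x * kerH j b x) / 4 := ⟨fun a b => _, fun a b => rfl⟩
  have key : kerH i * (kerH j).transpose = (4 : ℤ) • K := by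
    ext a b
    simp only [Matrix.mul_apply, Matrix.transpose_apply, Matrix.smul_apply, smul_eq_mul, hK]
    rcases kerH_cross i j hij a b with h | h <;> rw [h] <;> norm_num
  refine ⟨K, ⟨fun a b => ?_, ?_⟩, key⟩
  · rw [hK]
    rcases kerH_cross i j hij a b with h | h <;> rw [h] <;> norm_num
  · have h1 : ((4 : ℤ) • K) * ((4 : ℤ) • K).transpose
        = (256 : ℤ) • (1 : Matrix (Fin 16) (Fin 16) ℤ) := by
      rw [← key, Matrix.transpose_mul, Matrix.transpose_transpose, Matrix.mul_assoc,
        ← Matrix.mul_assoc (kerH j).transpose, kerH_transpose_mul, Matrix.smul_mul,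
        Matrix.one_mul, Matrix.mul_smul, kerH_mul_transpose, smul_smul]
      norm_num
    rw [Matrix.transpose_smul, Matrix.smul_mul, Matrix.mul_smul, smul_smul] at h1
    ext a b
    have h2 := congrFun (congrFun h1 a) b
    simp only [Matrix.smul_apply, smul_eq_mul] at h2 ⊢
    push_cast
    linarith
end

section
/- Let C be the binary [16,7] code spanned by the following seven vectors of F_2^16 (coordinates numbered 1 to 16): the five rows 1001011001101001, 0101010101010101, 0011001100110011, 0000111100001111, 0000000011111111 (a generator matrix of RM(1,4)), together with the vector with support {1, 8, 12, 14, 15, 16} and the vector with support {1, 4, 5, 7, 9, 10}. Then C has covering radius 4. -/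
open Finset

/-- The binary vector of length 16 whose coordinates are the bits of `n`. -/
def bitVec16 (n : ℕ) : Fin 16 → ZMod 2 := fun i => if n.testBit i then 1 else 0

/-- All XOR-combinations of a list of bit masks. -/
def xorSpan : List ℕ → List ℕ
  | [] => [0]
  | g :: gs => xorSpan gs ++ (xorSpan gs).map (fun a => g ^^^ a)

/-- Number of ones among the lowest 16 bits. -/
def pop16 (n : ℕ) : ℕ :=
  (List.range 16).foldr (fun i s => (n.testBit i).toNat + s) 0

def gens16 : List ℕ := [38505, 43690, 52428, 61680, 65280, 59521, 857]

/-- Unit vectors at the positions outside an information set. -/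
def units16 : List ℕ := [32, 128, 512, 1024, 2048, 4096, 8192, 16384, 32768]

/-- For each position a codeword clearing that position modulo the redundancy units. -/
def clear16 : List ℕ :=
  [59521, 20098, 45604, 58408, 27184, 0, 39616, 0, 65280, 0, 0, 0, 0, 0, 0, 0]

theorem bitVec16_xor (a b : ℕ) : bitVec16 (a ^^^ b) = bitVec16 a + bitVec16 b := by
  funext i
  simp only [bitVec16, Nat.testBit_xor, Pi.add_apply]
  cases a.testBit i <;> cases b.testBit i <;> decide

theorem bitVec16_zero : bitVec16 0 = 0 := by
  funext i
  simp [bitVec16]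

theorem wt_bitVec16 (n : ℕ) : wt (bitVec16 n) = pop16 n := by
  have h : ∀ i : Fin 16, (bitVec16 n i ≠ 0) ↔ n.testBit i = true := by
    intro i
    simp [bitVec16]
  unfold wt
  simp only [h, Finset.card_filter]
  simp only [pop16, Fin.sum_univ_succ, List.range, List.range.loop, List.foldr,
    Bool.toNat, Bool.cond_eq_ite]
  rfl

theorem neg_eq_self16 (x : Fin 16 → ZMod 2) : -x = x := by
  funext i
  exact ZMod.neg_eq_self_mod_two _

theorem mem_span_iff_xorSpan (gs : List ℕ) (x : Fin 16 → ZMod 2) :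
    x ∈ Submodule.span (ZMod 2) {v | ∃ g ∈ gs, v = bitVec16 g} ↔
      ∃ a ∈ xorSpan gs, x = bitVec16 a := by
  induction gs generalizing x with
  | nil => simp [xorSpan, bitVec16_zero]
  | cons g gs ih =>
    have hset : {v | ∃ h ∈ g :: gs, v = bitVec16 h} =
        insert (bitVec16 g) {v | ∃ h ∈ gs, v = bitVec16 h} := by
      ext v
      simp
    rw [hset, Submodule.mem_span_insert]
    constructor
    · rintro ⟨c, z, hz, rfl⟩
      obtain ⟨a, ha, rfl⟩ := (ih z).1 hz
      have hc : c = 0 ∨ c = 1 := by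
        revert c
        decide
      rcases hc with rfl | rfl
      · exact ⟨a, by simp [xorSpan, ha], by simp⟩
      · exact ⟨g ^^^ a, List.mem_append_right _ (List.mem_map_of_mem ha),
          by simp [bitVec16_xor]⟩
    · rintro ⟨a, ha, rfl⟩
      rcases List.mem_append.1 ha with ha | ha
      · exact ⟨0, _, (ih _).2 ⟨a, ha, rfl⟩, by simp⟩
      · obtain ⟨b, hb, rfl⟩ := List.mem_map.1 ha
        exact ⟨1, _, (ih _).2 ⟨b, hb, rfl⟩, by simp [bitVec16_xor]⟩

/-- A few codewords that already cover all the coset representatives. -/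
def cover16 : List ℕ :=
  [0, 65280, 59521, 45604, 20098, 58408, 39616, 27184, 32488, 9394, 23205, 61680, 6017, 38192, 3241, 64678, 33457, 43690, 15555, 15420, 21930, 54338, 36376, 19748, 26048, 42499, 22028, 6952, 45442, 55268, 55316, 29249, 10468]

theorem cover_mem16 : cover16.all (fun a => (xorSpan gens16).contains a) = true := by
  decide +kernel

theorem cover_check16 :
    (xorSpan units16).all (fun u => cover16.any
      (fun a => Nat.ble (pop16 (u ^^^ a)) 4)) = true := by
  decide +kernel

theorem far_check16 :
    (xorSpan gens16).all (fun a => Nat.ble 4 (pop16 (15 ^^^ a))) = true := by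
  decide +kernel

theorem clear_check16 :
    (List.range 16).all (fun p => (xorSpan gens16).contains (clear16.getD p 0) &&
      (xorSpan units16).contains (2 ^ p ^^^ clear16.getD p 0)) = true := by
  decide +kernel

theorem unit_eq_bitVec16 (p : Fin 16) : (Pi.single p 1 : Fin 16 → ZMod 2) = bitVec16 (2 ^ p.1) := by
  funext i
  simp only [bitVec16, Nat.testBit_two_pow, Pi.single_apply, decide_eq_true_eq, Fin.ext_iff]
  by_cases h : i.1 = p.1
  · simp [h]
  · simp [h, Ne.symm h]

theorem decompose16 (x : Fin 16 → ZMod 2) :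
    ∃ u ∈ xorSpan units16, ∃ a ∈ xorSpan gens16, x = bitVec16 u + bitVec16 a := by
  have key : x ∈ Submodule.span (ZMod 2) {v | ∃ g ∈ units16, v = bitVec16 g} ⊔
      Submodule.span (ZMod 2) {v | ∃ g ∈ gens16, v = bitVec16 g} := by
    rw [pi_eq_sum_univ' x]
    refine Submodule.sum_mem _ fun p _ => Submodule.smul_mem _ _ ?_
    have hp := List.all_eq_true.1 clear_check16 p.1 (List.mem_range.2 p.2)
    rw [Bool.and_eq_true, List.contains_iff_mem, List.contains_iff_mem] at hp
    have hs : (Pi.single p 1 : Fin 16 → ZMod 2) =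
        bitVec16 (2 ^ p.1 ^^^ clear16.getD p 0) + bitVec16 (clear16.getD p 0) := by
      rw [unit_eq_bitVec16, ← bitVec16_xor, Nat.xor_assoc, Nat.xor_self, Nat.xor_zero]
    have hs' : (fun j => if j = p then (1 : ZMod 2) else 0) = Pi.single p 1 := by
      funext j
      simp [Pi.single_apply]
    first
      | rw [hs', hs]
      | rw [hs]
    exact Submodule.add_mem_sup ((mem_span_iff_xorSpan _ _).2 ⟨_, hp.2, rfl⟩)
      ((mem_span_iff_xorSpan _ _).2 ⟨_, hp.1, rfl⟩)
  obtain ⟨y, hy, z, hz, rfl⟩ := Submodule.mem_sup.1 key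
  obtain ⟨u, hu, rfl⟩ := (mem_span_iff_xorSpan _ _).1 hy
  obtain ⟨a, ha, rfl⟩ := (mem_span_iff_xorSpan _ _).1 hz
  exact ⟨u, hu, a, ha, rfl⟩

theorem covRad_gens16 :
    covRad (↑(Submodule.span (ZMod 2) {v | ∃ g ∈ gens16, v = bitVec16 g}) :
      Set (Fin 16 → ZMod 2)) = 4 := by
  have hub : ∀ x : Fin 16 → ZMod 2, sInf {w : ℕ | ∃ c ∈
      (↑(Submodule.span (ZMod 2) {v | ∃ g ∈ gens16, v = bitVec16 g}) :
        Set (Fin 16 → ZMod 2)), w = wt (x - c)} ≤ 4 := by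
    intro x
    obtain ⟨u, hu, a, ha, rfl⟩ := decompose16 x
    obtain ⟨b, hb, hw⟩ := List.any_eq_true.1 (List.all_eq_true.1 cover_check16 u hu)
    replace hb := List.contains_iff_mem.1 (List.all_eq_true.1 cover_mem16 b hb)
    refine le_trans (Nat.sInf_le ⟨bitVec16 a + bitVec16 b, ?_, rfl⟩) ?_
    · exact Submodule.add_mem _ ((mem_span_iff_xorSpan _ _).2 ⟨a, ha, rfl⟩)
        ((mem_span_iff_xorSpan _ _).2 ⟨b, hb, rfl⟩)
    · have : bitVec16 u + bitVec16 a - (bitVec16 a + bitVec16 b) = bitVec16 (u ^^^ b) := by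
        rw [bitVec16_xor, ← sub_sub, add_sub_cancel_right, sub_eq_add_neg, neg_eq_self16]
      rw [this, wt_bitVec16]
      exact Nat.le_of_ble_eq_true hw
  unfold covRad
  apply le_antisymm
  · refine csSup_le ⟨_, 0, rfl⟩ ?_
    rintro r ⟨x, rfl⟩
    exact hub x
  · refine le_trans ?_ (le_csSup ⟨4, ?_⟩ ⟨bitVec16 15, rfl⟩)
    · refine le_csInf ⟨_, 0, Submodule.zero_mem _, rfl⟩ ?_
      rintro w ⟨c, hc, rfl⟩
      obtain ⟨a, ha, rfl⟩ := (mem_span_iff_xorSpan _ _).1 hc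
      rw [sub_eq_add_neg, neg_eq_self16, ← bitVec16_xor, wt_bitVec16]
      exact Nat.le_of_ble_eq_true (List.all_eq_true.1 far_check16 a ha)
    · rintro r ⟨x, rfl⟩
      exact hub x

/-- the `[16,7]` code spanned by a generator matrix of `RM(1,4)`
(rows `1001011001101001`, `0101010101010101`, `0011001100110011`,
`0000111100001111`, `0000000011111111`) together with the vectors with supports
`{1,8,12,14,15,16}` and `{1,4,5,7,9,10}` has covering radius 4. -/
theorem stmt16 :
    covRad (↑(Submodule.span (ZMod 2)
      ({![1,0,0,1,0,1,1,0,0,1,1,0,1,0,0,1],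
        ![0,1,0,1,0,1,0,1,0,1,0,1,0,1,0,1],
        ![0,0,1,1,0,0,1,1,0,0,1,1,0,0,1,1],
        ![0,0,0,0,1,1,1,1,0,0,0,0,1,1,1,1],
        ![0,0,0,0,0,0,0,0,1,1,1,1,1,1,1,1],
        ![1,0,0,0,0,0,0,1,0,0,0,1,0,1,1,1],
        ![1,0,0,1,1,0,1,0,1,1,0,0,0,0,0,0]} :
          Set (Fin 16 → ZMod 2))) : Set (Fin 16 → ZMod 2)) = 4 := by
  have hset : {v | ∃ g ∈ gens16, v = bitVec16 g} =
      ({![1,0,0,1,0,1,1,0,0,1,1,0,1,0,0,1],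
        ![0,1,0,1,0,1,0,1,0,1,0,1,0,1,0,1],
        ![0,0,1,1,0,0,1,1,0,0,1,1,0,0,1,1],
        ![0,0,0,0,1,1,1,1,0,0,0,0,1,1,1,1],
        ![0,0,0,0,0,0,0,0,1,1,1,1,1,1,1,1],
        ![1,0,0,0,0,0,0,1,0,0,0,1,0,1,1,1],
        ![1,0,0,1,1,0,1,0,1,1,0,0,0,0,0,0]} : Set (Fin 16 → ZMod 2)) := by
    have h1 : bitVec16 38505 = ![1,0,0,1,0,1,1,0,0,1,1,0,1,0,0,1] := by decide +kernel
    have h2 : bitVec16 43690 = ![0,1,0,1,0,1,0,1,0,1,0,1,0,1,0,1] := by decide +kernel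
    have h3 : bitVec16 52428 = ![0,0,1,1,0,0,1,1,0,0,1,1,0,0,1,1] := by decide +kernel
    have h4 : bitVec16 61680 = ![0,0,0,0,1,1,1,1,0,0,0,0,1,1,1,1] := by decide +kernel
    have h5 : bitVec16 65280 = ![0,0,0,0,0,0,0,0,1,1,1,1,1,1,1,1] := by decide +kernel
    have h6 : bitVec16 59521 = ![1,0,0,0,0,0,0,1,0,0,0,1,0,1,1,1] := by decide +kernel
    have h7 : bitVec16 857 = ![1,0,0,1,1,0,1,0,1,1,0,0,0,0,0,0] := by decide +kernel
    rw [← h1, ← h2, ← h3, ← h4, ← h5, ← h6, ← h7]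
    ext v
    simp only [gens16, List.mem_cons, List.not_mem_nil, or_false, Set.mem_ofPred_eq,
      exists_eq_or_imp, exists_eq_left, Set.mem_insert_iff, Set.mem_singleton_iff]
  rw [← hset]
  exact covRad_gens16
end

section
/- There exists a set of 4 mutually quasi-unbiased weighing matrices for parameters (32, 32, 4, 256); that is, there exist 4 Hadamard matrices H_1, …, H_4 of order 32 such that for all i ≠ j the matrix (1/16) · H_i H_j^T has entries in {0, 1, −1} and is a weighing matrix of order 32 and weight 4. -/
open Finset

/-- Order 8 Hadamard matrices from the quadratic forms `x₀ (i₀ x₁ + i₁ x₂)`. -/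
def qK (i : Fin 4) : Matrix (Fin 8) (Fin 8) ℤ := fun a x =>
  if ((a.val &&& x.val).testBit 0 ^^ (a.val &&& x.val).testBit 1 ^^ (a.val &&& x.val).testBit 2 ^^
    (x.val.testBit 0 && ((i.val.testBit 0 && x.val.testBit 1) ^^
      (i.val.testBit 1 && x.val.testBit 2)))) then -1 else 1

/-- The Sylvester matrix of order 4. -/
def qS : Matrix (Fin 4) (Fin 4) ℤ := fun a x =>
  if ((a.val &&& x.val).testBit 0 ^^ (a.val &&& x.val).testBit 1) then -1 else 1

/-- The order 8 weighing matrices `K_i K_jᵀ / 4`. -/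
def qW (i j : Fin 4) : Matrix (Fin 8) (Fin 8) ℤ := fun a b => (∑ x, qK i a x * qK j b x) / 4

/-- The index bijection. -/
def qe : Fin 32 ≃ Fin 8 × Fin 4 := (finProdFinEquiv (m := 8) (n := 4)).symm

theorem qK_pm (i a x) : qK i a x = 1 ∨ qK i a x = -1 := by
  unfold qK; split <;> simp

theorem qS_pm (a x) : qS a x = 1 ∨ qS a x = -1 := by
  unfold qS; split <;> simp

theorem qS_mul : qS * qS.transpose = (4 : ℤ) • (1 : Matrix (Fin 4) (Fin 4) ℤ) := by
  decide +kernel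

theorem qK_mul : ∀ i, qK i * (qK i).transpose = (8 : ℤ) • (1 : Matrix (Fin 8) (Fin 8) ℤ) := by
  decide +kernel

theorem qKK_mul : ∀ i j, i ≠ j → qK i * (qK j).transpose = (4 : ℤ) • qW i j := by
  decide +kernel

theorem qW_pm' : ∀ (i j : Fin 4) (a b : Fin 8),
    i = j ∨ (qW i j a b == 0 || qW i j a b == 1 || qW i j a b == -1) = true := by
  decide +kernel

theorem qW_pm (i j : Fin 4) (h : i ≠ j) (a b : Fin 8) :
    qW i j a b = 0 ∨ qW i j a b = 1 ∨ qW i j a b = -1 := by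
  have := (qW_pm' i j a b).resolve_left h
  simpa [or_assoc] using this

theorem qW_mul : ∀ i j, i ≠ j →
    qW i j * (qW i j).transpose = (4 : ℤ) • (1 : Matrix (Fin 8) (Fin 8) ℤ) := by
  decide +kernel

theorem q_mul (A B : Matrix (Fin 8) (Fin 8) ℤ) (C D : Matrix (Fin 4) (Fin 4) ℤ) :
    (Matrix.kronecker A C).submatrix qe qe * ((Matrix.kronecker B D).submatrix qe qe).transpose
      = (Matrix.kronecker (A * B.transpose) (C * D.transpose)).submatrix qe qe := by
  rw [Matrix.transpose_submatrix, Matrix.submatrix_mul_equiv]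
  congr 1
  exact (Matrix.mul_kronecker_mul A B.transpose C D.transpose).symm

theorem q_smul (c d : ℤ) (A : Matrix (Fin 8) (Fin 8) ℤ) (B : Matrix (Fin 4) (Fin 4) ℤ) :
    (Matrix.kronecker (c • A) (d • B)).submatrix qe qe
      = (c * d) • (Matrix.kronecker A B).submatrix qe qe := by
  ext a b
  simp only [Matrix.kronecker, Matrix.kroneckerMap_apply, Matrix.submatrix_apply,
    Matrix.smul_apply, smul_eq_mul]
  ring

theorem q_one : (Matrix.kronecker (1 : Matrix (Fin 8) (Fin 8) ℤ)
    (1 : Matrix (Fin 4) (Fin 4) ℤ)).submatrix qe qe = 1 := by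
  have h := Matrix.one_kronecker_one (α := ℤ) (m := Fin 8) (n := Fin 4)
  unfold Matrix.kronecker
  rw [h, Matrix.submatrix_one_equiv]

/-- there exist 4 mutually quasi-unbiased weighing matrices for
parameters `(32, 32, 4, 256)`. -/
theorem stmt19 :
    ∃ H : Fin 4 → Matrix (Fin 32) (Fin 32) ℤ,
      (∀ i, IsHadamard 32 (H i)) ∧
      ∀ i j, i ≠ j →
        ∃ W : Matrix (Fin 32) (Fin 32) ℤ,
          IsWeighing 32 4 W ∧ H i * (H j).transpose = (16 : ℤ) • W := by
  refine ⟨fun i => (Matrix.kronecker (qK i) qS).submatrix qe qe, fun i => ⟨fun a b => ?_, ?_⟩,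
    fun i j hij => ⟨(Matrix.kronecker (qW i j) 1).submatrix qe qe, ⟨fun a b => ?_, ?_⟩, ?_⟩⟩
  · rcases qK_pm i (qe a).1 (qe b).1 with h | h <;> rcases qS_pm (qe a).2 (qe b).2 with h' | h' <;>
      simp [Matrix.kronecker, Matrix.kroneckerMap_apply, h, h']
  · rw [q_mul, qK_mul, qS_mul]
    rw [q_smul, q_one]
    norm_num
  · rcases eq_or_ne (qe a).2 (qe b).2 with h' | h'
    · have h1 : (1 : Matrix (Fin 4) (Fin 4) ℤ) (qe a).2 (qe b).2 = 1 := by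
        rw [h', Matrix.one_apply_eq]
      simpa [Matrix.kronecker, Matrix.kroneckerMap_apply, h1] using
        qW_pm i j hij (qe a).1 (qe b).1
    · simp [Matrix.kronecker, Matrix.kroneckerMap_apply, Matrix.one_apply_ne h']
  · rw [q_mul, qW_mul i j hij, Matrix.transpose_one, Matrix.one_mul,
      ← one_smul ℤ (1 : Matrix (Fin 4) (Fin 4) ℤ), q_smul, q_one]
    norm_num
  · rw [q_mul, qKK_mul i j hij, qS_mul]
    rw [q_smul]
    norm_num
end
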